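/- For every integer n ≥ 2 and every integer k with 2 ≤ k < n, there exists a stable wiring s for the uniform (n,k)-BDNF game such that (i) for every pair of nodes v,u one has d_s(v,u) ≤ 2·⌈log_k n⌉, and (ii) the total social cost Σ_{v ∈ V} c_v(s) is at most twice the minimum of Σ_{v ∈ V} c_v(s') over all wirings s' on V with out-degree bound k. -/

import Mathlib

namespace BDNF

variable {V : Type} [DecidableEq V]

/-- `connIn s m v u` : there is a directed path with at most `m` edges from `v`
to `u` in the directed graph defined by the wiring `s`. -/
def connIn (s : V → Finset V) : ℕ → V → V → Prop
  | 0, v, u => v = u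
  | m + 1, v, u => v = u ∨ ∃ w ∈ s v, connIn s m w u

/-- Directed hop distance from `v` to `u`, with disconnection penalty `M`. -/
noncomputable def distW (s : V → Finset V) (M : ℕ) (v u : V) : ℕ := by
  classical exact if h : ∃ m, connIn s m v u then Nat.find h else M

/-- Cost of node `v` in the uniform game: the sum of its distances to all
other nodes. -/
noncomputable def cost [Fintype V] (s : V → Finset V) (M : ℕ) (v : V) : ℕ :=
  ∑ u ∈ Finset.univ.filter (fun u => u ≠ v), distW s M v u

/-- `s` is a wiring with out-degree bound `k`: every node links to at most `k`
other nodes. -/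
def IsWiring (k : ℕ) (s : V → Finset V) : Prop :=
  ∀ v, v ∉ s v ∧ (s v).card ≤ k

/-- `s` is stable (a pure Nash equilibrium) for the uniform game: no node can
strictly decrease its cost by rewiring its own out-links. -/
def Stable [Fintype V] (k M : ℕ) (s : V → Finset V) : Prop :=
  ∀ (v : V) (t : Finset V), v ∉ t → t.card ≤ k →
    cost s M v ≤ cost (Function.update s v t) M v

set_option linter.unusedSectionVars false

/-! ### Distances and costs -/

theorem connIn_refl (s : V → Finset V) (m : ℕ) (v : V) : connIn s m v v := by
  cases m <;> simp [connIn]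

theorem connIn_mono {s : V → Finset V} {a b : ℕ} (h : a ≤ b) {v u : V}
    (hc : connIn s a v u) : connIn s b v u := by
  induction b generalizing a v with
  | zero => obtain rfl := Nat.le_zero.mp h; exact hc
  | succ b ih =>
    cases a with
    | zero => exact Or.inl hc
    | succ a =>
      rcases hc with hc | ⟨w, hw, hc⟩
      · exact Or.inl hc
      · exact Or.inr ⟨w, hw, ih (by omega) hc⟩

theorem connIn_trans {s : V → Finset V} {a b : ℕ} {v w u : V}
    (h₁ : connIn s a v w) (h₂ : connIn s b w u) : connIn s (a + b) v u := by
  induction a generalizing v with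
  | zero => obtain rfl : v = w := h₁; simpa using h₂
  | succ a ih =>
    rcases h₁ with rfl | ⟨x, hx, h₁⟩
    · exact connIn_mono (by omega) h₂
    · rw [Nat.succ_add]; exact Or.inr ⟨x, hx, ih h₁⟩

theorem connIn_one {s : V → Finset V} {v u : V} (h : u ∈ s v) : connIn s 1 v u :=
  Or.inr ⟨u, h, rfl⟩

theorem distW_le {s : V → Finset V} {M m : ℕ} {v u : V} (h : connIn s m v u) :
    distW s M v u ≤ m := by
  classical
  have hex : ∃ m, connIn s m v u := ⟨m, h⟩
  unfold distW
  rw [dif_pos hex]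
  exact Nat.find_min' hex h

theorem le_distW {s : V → Finset V} {M a : ℕ} {v u : V} (haM : a ≤ M)
    (h : ∀ m, connIn s m v u → a ≤ m) : a ≤ distW s M v u := by
  classical
  unfold distW
  split_ifs with hex
  · exact h _ (Nat.find_spec hex)
  · exact haM

theorem distW_eq_of_not_connIn {s : V → Finset V} {M : ℕ} {v u : V}
    (h : ∀ m, ¬ connIn s m v u) : distW s M v u = M := by
  classical
  unfold distW
  rw [dif_neg]
  rintro ⟨m, hm⟩
  exact h m hm

theorem le_add_of_connIn {s : V → Finset V} {g : V → ℕ} (hg : ∀ a, ∀ b ∈ s a, g b ≤ g a + 1)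
    {m : ℕ} {v u : V} (h : connIn s m v u) : g u ≤ g v + m := by
  induction m generalizing v with
  | zero => obtain rfl : v = u := h; simp
  | succ m ih =>
    rcases h with rfl | ⟨w, hw, h⟩
    · omega
    · have := ih h
      have := hg v w hw
      omega

theorem distW_self (s : V → Finset V) (M : ℕ) (v : V) : distW s M v v = 0 :=
  Nat.le_zero.mp (distW_le (show connIn s 0 v v from rfl))

variable [Fintype V]

theorem cost_eq_sum_univ (s : V → Finset V) (M : ℕ) (v : V) :
    cost s M v = ∑ u, distW s M v u := by
  unfold cost
  rw [Finset.filter_ne']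
  exact Finset.sum_erase _ (distW_self s M v)

theorem cost_le {s : V → Finset V} {M : ℕ} {v : V} {g : V → ℕ}
    (h : ∀ u, u ≠ v → connIn s (g u) v u) :
    cost s M v ≤ ∑ u ∈ Finset.univ.filter (fun u => u ≠ v), g u :=
  Finset.sum_le_sum fun u hu => distW_le (h u (by simpa using hu))

/-- A potential that vanishes at `v` and grows by at most one along edges bounds distances from
`v` from below. -/
theorem le_cost_of_potential {s : V → Finset V} {M : ℕ} {v : V} {g : V → ℕ} (h₀ : g v = 0)
    (hM : ∀ u, g u ≤ M) (hg : ∀ a, ∀ b ∈ s a, g b ≤ g a + 1) :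
    ∑ u ∈ Finset.univ.filter (fun u => u ≠ v), g u ≤ cost s M v :=
  Finset.sum_le_sum fun u _ => le_distW (hM u) fun m hm => by
    simpa [h₀] using le_add_of_connIn hg hm

theorem penalty_le_cost {s : V → Finset V} {M : ℕ} {v u : V} (huv : u ≠ v)
    (h : ∀ a, u ∉ s a) : M ≤ cost s M v := by
  have h1 : ∀ m w, w ≠ u → ¬ connIn s m w u := by
    intro m
    induction m with
    | zero => intro w hw h; exact hw h
    | succ m ih =>
      rintro w hw (h' | ⟨x, hx, h'⟩)
      · exact hw h'
      · exact ih x (fun e => h w (e ▸ hx)) h'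
  have h2 : distW s M v u = M := distW_eq_of_not_connIn fun m => h1 m v huv.symm
  calc M = distW s M v u := h2.symm
    _ ≤ _ := Finset.single_le_sum (f := fun u => distW s M v u) (fun _ _ => Nat.zero_le _)
      (by simpa using huv)

/-- The largest possible number of nodes within distance `i` for out-degree `k`. -/
def geom (k i : ℕ) : ℕ := ∑ j ∈ Finset.range (i + 1), k ^ j

/-- The least possible cost of a node, as witnessed by the balls of radius less than `L`. -/
def costBound (k n L : ℕ) : ℕ := ∑ i ∈ Finset.range L, (n - geom k i)

open Classical in
theorem card_ball_le {k : ℕ} {s : V → Finset V} (hs : IsWiring k s) (i : ℕ) (v : V) :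
    (Finset.univ.filter fun u => connIn s i v u).card ≤ geom k i := by
  induction i generalizing v with
  | zero => 
    refine (Finset.card_le_card (t := {v}) fun u hu => ?_).trans (by simp [geom])
    have : v = u := (Finset.mem_filter.mp hu).2
    simp [this]
  | succ i ih =>
    have hsub : (Finset.univ.filter fun u => connIn s (i + 1) v u) ⊆
        {v} ∪ (s v).biUnion fun w => Finset.univ.filter fun u => connIn s i w u := by
      intro u hu
      replace hu := (Finset.mem_filter.mp hu).2
      simp only [Finset.mem_union, Finset.mem_singleton, Finset.mem_biUnion, Finset.mem_filter,
        Finset.mem_univ, true_and]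
      exact Or.imp Eq.symm id hu
    refine (Finset.card_le_card hsub).trans ((Finset.card_union_le _ _).trans ?_)
    have h1 := Finset.card_biUnion_le_card_mul (s v)
      (fun w => Finset.univ.filter fun u => connIn s i w u) (geom k i) (fun w _ => ih w)
    have h2 : (s v).card * geom k i ≤ k * geom k i := Nat.mul_le_mul_right _ (hs v).2
    have h3 : geom k (i + 1) = k * geom k i + 1 := by
      unfold geom
      rw [Finset.sum_range_succ', Finset.mul_sum]
      simp [pow_succ, mul_comm]
    rw [Finset.card_singleton]
    omega

theorem sum_compl_ball_le_cost {s : V → Finset V} {L M : ℕ} (hLM : L ≤ M) (v : V)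
    {b : ℕ → ℕ} (hb : ∀ i < L, ∀ B : Finset V, (∀ u ∈ B, connIn s i v u) → B.card ≤ b i) :
    ∑ i ∈ Finset.range L, (Fintype.card V - b i) ≤ cost s M v := by
  classical
  have key : ∀ u, ∑ i ∈ Finset.range L, (if connIn s i v u then 0 else 1) ≤ distW s M v u := by
    intro u
    have : ∑ i ∈ Finset.range L, (if connIn s i v u then 0 else 1) =
        ((Finset.range L).filter fun i => ¬ connIn s i v u).card := by
      rw [Finset.card_filter]
      exact Finset.sum_congr rfl fun i _ => by split_ifs <;> rfl
    rw [this]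
    refine le_distW ?_ fun m hm => ?_
    · exact (Finset.card_filter_le _ _).trans (by simpa using hLM)
    · refine (Finset.card_le_card (t := Finset.range m) fun i hi => ?_).trans (by simp)
      simp only [Finset.mem_filter] at hi
      by_contra hcon
      simp only [Finset.mem_range, not_lt] at hcon
      exact hi.2 (connIn_mono hcon hm)
  rw [cost_eq_sum_univ]
  refine le_trans ?_ (Finset.sum_le_sum fun u _ => key u)
  rw [Finset.sum_comm]
  refine Finset.sum_le_sum fun i hi => ?_
  have h1 : ∑ u : V, (if connIn s i v u then 0 else 1) =
      (Finset.univ.filter fun u => ¬ connIn s i v u).card := by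
    rw [Finset.card_filter]
    exact Finset.sum_congr rfl fun i _ => by split_ifs <;> rfl
  have h2 := Finset.card_filter_add_card_filter_not (s := (Finset.univ : Finset V))
    (fun u => connIn s i v u)
  have h3 := hb i (Finset.mem_range.mp hi) (Finset.univ.filter fun u => connIn s i v u) (by simp)
  rw [Finset.card_univ] at h2
  rw [h1]
  omega

theorem costBound_le_cost {k L M : ℕ} {s : V → Finset V} (hs : IsWiring k s) (hLM : L ≤ M)
    (v : V) : costBound k (Fintype.card V) L ≤ cost s M v := by
  classical
  refine sum_compl_ball_le_cost hLM v fun i _ B hB => ?_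
  exact (Finset.card_le_card fun u hu => by simpa using hB u hu).trans (card_ball_le hs i v)

theorem isWiring_update {k : ℕ} {s : V → Finset V} (hs : IsWiring k s) {v : V} {t : Finset V}
    (hv : v ∉ t) (ht : t.card ≤ k) : IsWiring k (Function.update s v t) := by
  intro u
  by_cases h : u = v
  · subst h; simp [hv, ht]
  · simpa [Function.update_of_ne h] using hs u

/-- The conclusion of the main theorem for the node set `V`, with the universal lower bound on
costs in place of the optimal social cost. -/
def Good (V : Type) [DecidableEq V] [Fintype V] (k M : ℕ) : Prop :=
  ∃ s : V → Finset V, IsWiring k s ∧ Stable k M s ∧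
    (∀ v u : V, distW s M v u ≤ 2 * Nat.clog k (Fintype.card V)) ∧
    ∃ L ≤ M, ∑ v : V, cost s M v ≤
      2 * (Fintype.card V * costBound k (Fintype.card V) L)

theorem connIn_map {W : Type} [DecidableEq W] (e : V ≃ W) (s : V → Finset V) (m : ℕ) (v u : V) :
    connIn (fun w => (s (e.symm w)).map e.toEmbedding) m (e v) (e u) ↔ connIn s m v u := by
  induction m generalizing v with
  | zero => simp [connIn]
  | succ m ih =>
    simp only [connIn, e.apply_eq_iff_eq, Equiv.symm_apply_apply]
    refine or_congr_right ⟨?_, ?_⟩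
    · rintro ⟨w, hw, h⟩
      obtain ⟨x, rfl⟩ := e.surjective w
      exact ⟨x, by simpa using hw, (ih x).mp h⟩
    · rintro ⟨x, hx, h⟩
      exact ⟨e x, by simpa using hx, (ih x).mpr h⟩

theorem distW_map {W : Type} [DecidableEq W] (e : V ≃ W) (s : V → Finset V) (M : ℕ) (v u : V) :
    distW (fun w => (s (e.symm w)).map e.toEmbedding) M (e v) (e u) = distW s M v u := by
  classical
  unfold distW
  by_cases hex : ∃ m, connIn s m v u
  · have hex' := hex
    simp only [← connIn_map e s] at hex'
    rw [dif_pos hex, dif_pos hex']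
    exact Nat.find_congr' (connIn_map e s _ v u)
  · have hex' := hex
    simp only [← connIn_map e s] at hex'
    rw [dif_neg hex, dif_neg hex']

theorem cost_map {W : Type} [DecidableEq W] [Fintype W] (e : V ≃ W) (s : V → Finset V) (M : ℕ)
    (v : V) : cost (fun w => (s (e.symm w)).map e.toEmbedding) M (e v) = cost s M v := by
  rw [cost_eq_sum_univ, cost_eq_sum_univ, ← e.sum_comp]
  exact Finset.sum_congr rfl fun u _ => distW_map e s M v u

theorem Good.of_equiv {W : Type} [DecidableEq W] [Fintype W] (e : V ≃ W) {k M : ℕ}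
    (h : Good V k M) : Good W k M := by
  obtain ⟨s, hw, hst, hd, L, hL, hc⟩ := h
  refine ⟨fun w => (s (e.symm w)).map e.toEmbedding, fun w => ?_, fun w t hwt ht => ?_,
    fun v u => ?_, L, hL, ?_⟩
  · obtain ⟨v, rfl⟩ := e.surjective w
    simpa using hw v
  · obtain ⟨v, rfl⟩ := e.surjective w
    rw [cost_map]
    have h1 := hst v (t.map e.symm.toEmbedding)
      (by simpa [Finset.mem_map_equiv] using hwt) (by simpa using ht)
    rw [← cost_map e (Function.update _ _ _)] at h1
    convert h1 using 2
    funext x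
    obtain ⟨y, rfl⟩ := e.surjective x
    by_cases hy : y = v
    · subst hy
      simp only [Function.update_self, Equiv.symm_apply_apply, Finset.map_map]
      ext a
      simp
    · rw [Function.update_of_ne (by simpa using hy)]
      simp only [Equiv.symm_apply_apply]
      rw [Function.update_of_ne hy]
  · obtain ⟨v, rfl⟩ := e.surjective v
    obtain ⟨u, rfl⟩ := e.surjective u
    rw [distW_map, ← Fintype.card_congr e]
    exact hd v u
  · rw [← Fintype.card_congr e, ← e.sum_comp]
    simpa only [cost_map] using hc

/-- A wiring in which every node attains the universal lower bound is stable and optimal. -/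
theorem good_of_cost_le {k M L : ℕ} {s : V → Finset V} (hs : IsWiring k s) (hLM : L ≤ M)
    (hd : ∀ v u : V, distW s M v u ≤ 2 * Nat.clog k (Fintype.card V))
    (hc : ∀ v, cost s M v ≤ costBound k (Fintype.card V) L) : Good V k M := by
  refine ⟨s, hs, fun v t hv ht => ?_, hd, L, hLM, ?_⟩
  · exact (hc v).trans (costBound_le_cost (isWiring_update hs hv ht) hLM v)
  · refine (Finset.sum_le_sum fun v _ => hc v).trans ?_
    simp only [Finset.sum_const, Finset.card_univ, smul_eq_mul]
    omega

/-! ### At most `k ^ 2 + k` nodes: sub-digraphs of the Kautz digraph -/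

theorem two_le_two_mul_clog {k n : ℕ} (hk : 2 ≤ k) (hn : 2 ≤ n) : 2 ≤ 2 * Nat.clog k n := by
  have := Nat.clog_pos hk hn
  omega

theorem good_of_le_kautz {n k M : ℕ} (hk : 2 ≤ k) (hkn : k < n) (hn : n ≤ k ^ 2 + k)
    (hM : n ^ 2 < M) : Good (Fin n) k M := by
  classical
  let c : Finset (Fin (k + 1) × Fin (k + 1)) := Finset.univ.image fun b => (b + 1, b)
  have hne : ∀ b : Fin (k + 1), b + 1 ≠ b := by
    intro b h
    have h1 := congrArg Fin.val h
    rw [Fin.val_add_one] at h1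
    split_ifs at h1 with hl
    · rw [hl, Fin.val_last] at h1
      omega
    · omega
  have hc : c ⊆ Finset.offDiag Finset.univ := by
    intro x hx
    obtain ⟨b, -, rfl⟩ := Finset.mem_image.mp hx
    simpa using hne b
  have hcard : c.card = k + 1 := by
    rw [Finset.card_image_of_injective _ (fun a b h => (Prod.mk.inj h).2)]
    simp
  obtain ⟨A, hcA, hA, hAn⟩ := Finset.exists_subsuperset_card_eq (n := n) hc (by omega) (by
    rw [Finset.offDiag_card]
    simp only [Finset.card_univ, Fintype.card_fin]
    have : (k + 1) * (k + 1) - (k + 1) = k ^ 2 + k := by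
      rw [Nat.sub_eq_iff_eq_add (by nlinarith)]; ring
    omega)
  have hbc : ∀ b : Fin (k + 1), (b + 1, b) ∈ A := fun b => hcA (by simp [c])
  have hoff : ∀ x ∈ A, x.1 ≠ x.2 := fun x hx => (Finset.mem_offDiag.mp (hA hx)).2.2
  let f : ↥A → Fin (k + 1) → ↥A := fun v b =>
    if h : (v.1.2, b) ∈ A then ⟨(v.1.2, b), h⟩ else ⟨(b + 1, b), hbc b⟩
  have hf2 : ∀ v b, (f v b).1.2 = b := by
    intro v b; simp only [f]; split_ifs <;> rfl
  have hf1 : ∀ v b (h : (v.1.2, b) ∈ A), f v b = ⟨(v.1.2, b), h⟩ := by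
    intro v b h; simp only [f]; rw [dif_pos h]
  let s : ↥A → Finset ↥A := fun v => (Finset.univ.erase v.1.2).image (f v)
  have hmem : ∀ v b, b ≠ v.1.2 → f v b ∈ s v := fun v b hb =>
    Finset.mem_image_of_mem _ (by simpa using hb)
  have hcs : ∀ v, (s v).card = k := by
    intro v
    simp only [s]
    rw [Finset.card_image_of_injective _ (fun a b h => by rw [← hf2 v a, h, hf2])]
    simp
  have hw : IsWiring k s := by
    intro v
    refine ⟨fun hv => ?_, (hcs v).le⟩
    obtain ⟨b, hb, hv⟩ := Finset.mem_image.mp hv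
    have := hf2 v b
    rw [hv] at this
    exact (Finset.mem_erase.mp hb).1 this.symm
  have h2 : ∀ v u, connIn s 2 v u := by
    intro v u
    by_cases h : u.1.1 = v.1.2
    · have hu : (v.1.2, u.1.2) ∈ A := by rw [← h]; exact u.2
      have h1 := hmem v u.1.2 (by rw [← h]; exact (hoff _ u.2).symm)
      rw [hf1 v _ hu] at h1
      have h3 : (⟨(v.1.2, u.1.2), hu⟩ : ↥A) = u := Subtype.ext (Prod.ext h.symm rfl)
      rw [h3] at h1
      exact connIn_mono (by omega) (connIn_one h1)
    · have h1 := hmem v u.1.1 h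
      have h4 := hf2 v u.1.1
      have hu : ((f v u.1.1).1.2, u.1.2) ∈ A := by rw [h4]; exact u.2
      have h5 := hmem (f v u.1.1) u.1.2 (by rw [h4]; exact (hoff _ u.2).symm)
      rw [hf1 _ _ hu] at h5
      have h3 : (⟨((f v u.1.1).1.2, u.1.2), hu⟩ : ↥A) = u := Subtype.ext (Prod.ext h4 rfl)
      rw [h3] at h5
      exact connIn_trans (connIn_one h1) (connIn_one h5)
  have hcV : Fintype.card ↥A = n := by rw [Fintype.card_coe, hAn]
  have hcost : ∀ v, cost s M v ≤ costBound k n 2 := by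
    intro v
    refine (cost_le (g := fun u => if u ∈ s v then 1 else 2) fun u _ => ?_).trans ?_
    · split_ifs with h
      · exact connIn_one h
      · exact h2 v u
    · have e1 : ∑ u ∈ Finset.univ.filter (fun u => u ≠ v), (if u ∈ s v then 1 else 2) +
          (s v).card = 2 * (n - 1) := by
        have : (s v).card = ∑ u ∈ Finset.univ.filter (fun u => u ≠ v),
            (if u ∈ s v then 1 else 0) := by
          rw [← Finset.card_filter]
          congr 1
          ext u
          simp only [Finset.mem_filter, Finset.mem_univ, true_and]
          exact ⟨fun h => ⟨fun e => (hw v).1 (e ▸ h), h⟩, fun h => h.2⟩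
        rw [this, ← Finset.sum_add_distrib, Finset.sum_congr rfl (g := fun _ => 2)]
        · rw [Finset.sum_const, Finset.filter_ne', Finset.card_erase_of_mem (Finset.mem_univ _),
            Finset.card_univ, hcV, smul_eq_mul, mul_comm]
        · intro u _; split_ifs <;> rfl
      have e2 : costBound k n 2 = (n - 1) + (n - (1 + k)) := by
        simp [costBound, geom, Finset.sum_range_succ]
      have e3 := hcs v
      omega
  refine Good.of_equiv (Fintype.equivFinOfCardEq hcV) (good_of_cost_le hw (L := 2) ?_ ?_ ?_)
  · nlinarith
  · intro v u
    rw [hcV]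
    exact (distW_le (h2 v u)).trans (two_le_two_mul_clog hk (by omega))
  · rw [hcV]; exact hcost

theorem exists_of_good {n k M : ℕ} (h : Good (Fin n) k M) :
    ∃ s : Fin n → Finset (Fin n), IsWiring k s ∧ Stable k M s ∧
      (∀ v u : Fin n, distW s M v u ≤ 2 * Nat.clog k n) ∧
      (∀ s' : Fin n → Finset (Fin n), IsWiring k s' →
        ∑ v : Fin n, cost s M v ≤ 2 * ∑ v : Fin n, cost s' M v) := by
  obtain ⟨s, hw, hst, hd, L, hL, hc⟩ := h
  refine ⟨s, hw, hst, by simpa using hd, fun s' hs' => hc.trans (Nat.mul_le_mul_left _ ?_)⟩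
  have := Finset.card_nsmul_le_sum Finset.univ (fun v => cost s' M v) _
    fun v _ => costBound_le_cost hs' hL v
  simpa using this

/-! ### Forests whose remaining links all enter the roots -/

/-- A forest on `V` with `k` roots (the nodes of depth one), at most `k` children per node and
height at most `L`; `T z` is the set of descendants of `z`. The nodes with fewer than `k` children
only have childless children, and `P v` is the set of roots that `v` links to. -/
structure Forest (V : Type) [DecidableEq V] [Fintype V] (k L : ℕ) where
  dep : V → ℕ
  kids : V → Finset V
  T : V → Finset V
  P : V → Finset V
  dep_pos : ∀ v, 1 ≤ dep v
  dep_le : ∀ v, dep v ≤ L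
  dep_kid : ∀ {a b}, b ∈ kids a → dep b = dep a + 1
  exists_parent : ∀ {b}, dep b ≠ 1 → ∃ a, b ∈ kids a
  parent_unique : ∀ {a a' b}, b ∈ kids a → b ∈ kids a' → a = a'
  mem_T_root : ∀ {r z}, dep r = 1 → (r ∈ T z ↔ z = r)
  mem_T_kid : ∀ {a b z}, b ∈ kids a → (b ∈ T z ↔ z = b ∨ a ∈ T z)
  card_kids_le : ∀ v, (kids v).card ≤ k
  card_kids_root : ∀ {v}, dep v = 1 → (kids v).card = k
  card_roots : (Finset.univ.filter fun v => dep v = 1).card = k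
  kids_kid : ∀ {a b}, (kids a).card < k → b ∈ kids a → kids b = ∅
  P_root : ∀ {v r}, r ∈ P v → dep r = 1
  P_card : ∀ v, (kids v).card + (P v).card ≤ k
  P_leaf : ∀ {v r}, kids v = ∅ → dep r = 1 → r ∈ P v

namespace Forest

variable {V : Type} [DecidableEq V] [Fintype V] {k L : ℕ} (F : Forest V k L)

/-- The wiring of the forest. -/
def wiring (v : V) : Finset V := F.kids v ∪ F.P v

/-- The number of descendants of `z` other than `v` and its children. -/
def wt (v z : V) : ℕ := (F.T z \ insert v (F.kids v)).card

theorem isWiring : IsWiring k F.wiring := by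
  intro v
  refine ⟨fun hv => ?_, (Finset.card_union_le _ _).trans (F.P_card v)⟩
  rcases Finset.mem_union.mp hv with h | h
  · have := F.dep_kid h; omega
  · have h1 := F.card_kids_root (F.P_root h)
    have h2 := F.P_card v
    have h3 := Finset.card_pos.mpr ⟨v, h⟩
    omega

theorem rec_dep {p : V → Prop} (root : ∀ r, F.dep r = 1 → p r)
    (kid : ∀ a, ∀ b ∈ F.kids a, p a → p b) (v : V) : p v := by
  induction h : F.dep v using Nat.strong_induction_on generalizing v with
  | _ d ih =>
    by_cases hv : F.dep v = 1
    · exact root v hv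
    · obtain ⟨a, ha⟩ := F.exists_parent hv
      exact kid a v ha (ih (F.dep a) (by have := F.dep_kid ha; omega) a rfl)

theorem mem_T_self (v : V) : v ∈ F.T v := by
  by_cases hv : F.dep v = 1
  · exact (F.mem_T_root hv).mpr rfl
  · obtain ⟨a, ha⟩ := F.exists_parent hv
    exact (F.mem_T_kid ha).mpr (Or.inl rfl)

theorem dep_le_of_mem_T {y z : V} : y ∈ F.T z → F.dep z ≤ F.dep y := by
  refine F.rec_dep (p := fun y => y ∈ F.T z → F.dep z ≤ F.dep y) ?_ ?_ y
  · intro r hr h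
    rw [(F.mem_T_root hr).mp h]
  · intro a b hb ih h
    rcases (F.mem_T_kid hb).mp h with rfl | h
    · exact le_rfl
    · have := ih h
      have := F.dep_kid hb
      omega

theorem exists_root (y : V) : ∃ r, F.dep r = 1 ∧ y ∈ F.T r := by
  refine F.rec_dep (p := fun y => ∃ r, F.dep r = 1 ∧ y ∈ F.T r)
    (fun r hr => ⟨r, hr, F.mem_T_self r⟩) ?_ y
  rintro a b hb ⟨r, hr, ha⟩
  exact ⟨r, hr, (F.mem_T_kid hb).mpr (Or.inr ha)⟩

theorem root_unique {y r r' : V} (hr : F.dep r = 1) (hr' : F.dep r' = 1) :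
    y ∈ F.T r → y ∈ F.T r' → r = r' := by
  refine F.rec_dep (p := fun y => y ∈ F.T r → y ∈ F.T r' → r = r') ?_ ?_ y
  · intro x hx h h'
    rw [(F.mem_T_root hx).mp h, (F.mem_T_root hx).mp h']
  · intro a b hb ih h h'
    have hd := F.dep_kid hb
    have hp := F.dep_pos a
    rcases (F.mem_T_kid hb).mp h with rfl | h
    · omega
    · rcases (F.mem_T_kid hb).mp h' with rfl | h'
      · omega
      · exact ih h h'

theorem connIn_of_mem_T {y z : V} : y ∈ F.T z → connIn F.wiring (F.dep y - F.dep z) z y := by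
  refine F.rec_dep (p := fun y => y ∈ F.T z → connIn F.wiring (F.dep y - F.dep z) z y) ?_ ?_ y
  · intro r hr h
    obtain rfl := (F.mem_T_root hr).mp h
    exact connIn_refl _ _ _
  · intro a b hb ih h
    rcases (F.mem_T_kid hb).mp h with rfl | h
    · exact connIn_refl _ _ _
    · have h1 := F.dep_le_of_mem_T h
      have h2 := F.dep_kid hb
      have h3 := connIn_trans (ih h) (connIn_one (s := F.wiring) (Finset.mem_union_left (F.P a) hb))
      exact connIn_mono (by omega) h3

theorem connIn_of_mem_P {v r y : V} (hr : r ∈ F.P v) (hy : y ∈ F.T r) :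
    connIn F.wiring (F.dep y) v y := by
  have h1 := F.P_root hr
  have h2 := F.dep_le_of_mem_T hy
  refine connIn_mono ?_ (connIn_trans
    (connIn_one (s := F.wiring) (Finset.mem_union_right (F.kids v) hr)) (F.connIn_of_mem_T hy))
  omega

theorem connIn_of_leaf {v : V} (hv : F.kids v = ∅) (y : V) :
    connIn F.wiring (F.dep y) v y := by
  obtain ⟨r, hr, hy⟩ := F.exists_root y
  exact F.connIn_of_mem_P (F.P_leaf hv hr) hy

theorem connIn_depth (v y : V) : connIn F.wiring (L - F.dep v + F.dep y) v y := by
  induction h : L - F.dep v using Nat.strong_induction_on generalizing v with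
  | _ d ih =>
    rcases (F.kids v).eq_empty_or_nonempty with hv | ⟨b, hb⟩
    · exact connIn_mono (by omega) (F.connIn_of_leaf hv y)
    · have h1 := F.dep_kid hb
      have h2 := F.dep_le b
      have h3 := ih (L - F.dep b) (by omega) b rfl
      exact connIn_mono (by omega) (connIn_trans
        (connIn_one (s := F.wiring) (Finset.mem_union_left (F.P v) hb)) h3)

theorem connIn_two_mul (v y : V) : connIn F.wiring (2 * L - 1) v y :=
  connIn_mono (by have := F.dep_pos v; have := F.dep_le y; have := F.dep_le v; omega)
    (F.connIn_depth v y)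

theorem sum_wt_P_le (v : V) : ∑ r ∈ F.P v, F.wt v r ≤
    ∑ y ∈ Finset.univ.filter (fun y => y ≠ v),
      (if y ∉ F.kids v ∧ ∃ r ∈ F.P v, y ∈ F.T r then 1 else 0) := by
  have h1 : ∀ r, F.wt v r = ∑ y ∈ Finset.univ.filter (fun y => y ≠ v),
      (if y ∈ F.T r \ insert v (F.kids v) then 1 else 0) := by
    intro r
    rw [wt, ← Finset.card_filter]
    congr 1
    ext y
    simp only [Finset.mem_sdiff, Finset.mem_insert, Finset.mem_filter, Finset.mem_univ, true_and]
    tauto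
  simp_rw [h1]
  rw [Finset.sum_comm]
  refine Finset.sum_le_sum fun y _ => ?_
  rw [← Finset.card_filter]
  split_ifs with h
  · refine Finset.card_le_one.mpr fun a ha b hb => ?_
    simp only [Finset.mem_filter, Finset.mem_sdiff] at ha hb
    exact F.root_unique (F.P_root ha.1) (F.P_root hb.1) ha.2.1 hb.2.1
  · simp only [Nat.le_zero, Finset.card_eq_zero]
    refine Finset.filter_eq_empty_iff.mpr fun r hr hy => h ?_
    simp only [Finset.mem_sdiff, Finset.mem_insert, not_or] at hy
    exact ⟨hy.2.2, r, hr, hy.1⟩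

theorem sum_sup_le (v : V) (Q : Finset V) (f : V → ℕ) :
    ∑ y ∈ Finset.univ.filter (fun y => y ≠ v),
      (if y ∈ F.kids v then 0 else (Q.filter fun z => y ∈ F.T z).sup f) ≤
    ∑ z ∈ Q, f z * F.wt v z := by
  have h1 : ∀ z, f z * F.wt v z = ∑ y ∈ Finset.univ.filter (fun y => y ≠ v),
      (if y ∈ F.T z \ insert v (F.kids v) then f z else 0) := by
    intro z
    rw [← Finset.sum_filter, Finset.sum_const, smul_eq_mul, mul_comm, wt]
    congr 2
    ext y
    simp only [Finset.mem_sdiff, Finset.mem_insert, Finset.mem_filter, Finset.mem_univ, true_and]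
    tauto
  simp_rw [h1]
  rw [Finset.sum_comm]
  refine Finset.sum_le_sum fun y hy => ?_
  have hyv : y ≠ v := by simpa using hy
  split_ifs with h
  · exact Nat.zero_le _
  · refine Finset.sup_le fun z hz => ?_
    obtain ⟨hzQ, hyz⟩ := Finset.mem_filter.mp hz
    refine le_trans ?_ (Finset.single_le_sum (fun _ _ => Nat.zero_le _) hzQ)
    rw [if_pos]
    simp [hyz, hyv, h]

theorem sup_le_of_mem_T (f : V → ℕ) {Q : Finset V} {a b : V} (hb : b ∈ F.kids a) :
    (Q.filter fun z => a ∈ F.T z).sup f ≤ (Q.filter fun z => b ∈ F.T z).sup f :=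
  Finset.sup_mono fun z hz => by
    obtain ⟨h1, h2⟩ := Finset.mem_filter.mp hz
    exact Finset.mem_filter.mpr ⟨h1, (F.mem_T_kid hb).mpr (Or.inr h2)⟩

theorem le_sup_self (f : V → ℕ) {Q : Finset V} {b : V} (hb : b ∈ Q) :
    f b ≤ (Q.filter fun z => b ∈ F.T z).sup f :=
  Finset.le_sup (f := f) (Finset.mem_filter.mpr ⟨hb, F.mem_T_self b⟩)

theorem sup_dep_le {Q : Finset V} {y : V} :
    (Q.filter fun z => y ∈ F.T z).sup F.dep ≤ F.dep y :=
  Finset.sup_le fun _ hz => F.dep_le_of_mem_T (Finset.mem_filter.mp hz).2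

theorem cost_le_update_of_wt {M : ℕ} (hM : L + 2 ≤ M) {v : V} {Q : Finset V}
    (hv : (F.kids v).card < k)
    (hQ : ∑ z ∈ Q, F.dep z * F.wt v z ≤ ∑ r ∈ F.P v, F.wt v r) :
    cost F.wiring M v ≤ cost (Function.update F.wiring v (F.kids v ∪ Q)) M v := by
  set h : V → ℕ := fun y => (Q.filter fun z => y ∈ F.T z).sup F.dep with hh
  have hle : ∀ y, h y ≤ F.dep y := fun y => F.sup_dep_le
  have hlow := le_cost_of_potential (s := Function.update F.wiring v (F.kids v ∪ Q)) (M := M)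
    (v := v) (g := fun y => if y = v then 0 else if y ∈ F.kids v then 1 else F.dep y + 1 - h y)
    (by simp) (fun u => by have := F.dep_le u; split_ifs <;> omega) (by
      intro a b hb
      by_cases hbv : b = v
      · simp [hbv]
      by_cases hbk : b ∈ F.kids v
      · simp [hbv, hbk]
      rw [if_neg hbv, if_neg hbk]
      by_cases hav : a = v
      · subst hav
        rw [Function.update_self] at hb
        have hbQ := (Finset.mem_union.mp hb).resolve_left hbk
        have := F.le_sup_self F.dep hbQ
        simp only [hh, if_true]
        omega
      rw [Function.update_of_ne hav] at hb
      have ha := hle a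
      rw [if_neg hav]
      rcases Finset.mem_union.mp hb with hb | hb
      · have hak : a ∉ F.kids v := fun hak => by
          rw [F.kids_kid hv hak] at hb; simp at hb
        rw [if_neg hak]
        have h1 := F.dep_kid hb
        have h2 : h a ≤ h b := F.sup_le_of_mem_T F.dep hb
        omega
      · have h1 := F.P_root hb
        split_ifs <;> omega)
  have hup := cost_le (s := F.wiring) (M := M) (v := v)
    (g := fun y => if y ∈ F.kids v then 1 else F.dep y +
      if ∃ r ∈ F.P v, y ∈ F.T r then 0 else 1) (by
      intro u hu
      split_ifs with h1 h2
      · exact connIn_one (Finset.mem_union_left _ h1)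
      · obtain ⟨r, hr, hy⟩ := h2
        exact F.connIn_of_mem_P hr hy
      · rcases (F.kids v).eq_empty_or_nonempty with hk | ⟨b, hb⟩
        · obtain ⟨r, hr, hy⟩ := F.exists_root u
          exact absurd ⟨r, F.P_leaf hk hr, hy⟩ h2
        · rw [add_comm]
          exact connIn_trans (connIn_one (Finset.mem_union_left _ hb))
            (F.connIn_of_leaf (F.kids_kid hv hb) u))
  refine hup.trans (le_trans ?_ hlow)
  have hp := F.sum_wt_P_le v
  have hq := F.sum_sup_le v Q F.dep
  have e1 := Finset.sum_congr (rfl : Finset.univ.filter (fun y => y ≠ v) = _) (fun y hy =>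
    show ((if y ∈ F.kids v then 1 else F.dep y + if ∃ r ∈ F.P v, y ∈ F.T r then 0 else 1) +
        if y ∉ F.kids v ∧ ∃ r ∈ F.P v, y ∈ F.T r then 1 else 0) =
      (if y = v then 0 else if y ∈ F.kids v then 1 else F.dep y + 1 - h y) +
        if y ∈ F.kids v then 0 else h y by
    have hyv : y ≠ v := by simpa using hy
    have := hle y
    by_cases h1 : y ∈ F.kids v
    · simp [hyv, h1]
    · by_cases h2 : ∃ r ∈ F.P v, y ∈ F.T r
      · rw [if_neg h1, if_pos h2, if_pos ⟨h1, h2⟩, if_neg hyv, if_neg h1, if_neg h1]; omega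
      · rw [if_neg h1, if_neg h2, if_neg (fun h => h2 h.2), if_neg hyv, if_neg h1, if_neg h1]
        omega)
  rw [Finset.sum_add_distrib, Finset.sum_add_distrib] at e1
  simp only [hh] at e1 ⊢
  omega

theorem cost_le_update_of_full {M : ℕ} (hM : L + 2 ≤ M) {v : V} {Q : Finset V}
    (hv : F.kids v = ∅) (hfull : ∀ z ∈ Q, (F.kids z).card = k)
    (hQ : ∑ z ∈ Q, (F.dep z + 1) * F.wt v z ≤ 2 * (Fintype.card V - 1)) :
    cost F.wiring M v ≤ cost (Function.update F.wiring v Q) M v := by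
  set h : V → ℕ := fun y => (Q.filter fun z => y ∈ F.T z).sup fun z => F.dep z + 1 with hh
  have hle : ∀ y, h y ≤ F.dep y + 1 := fun y => Finset.sup_le fun z hz =>
    Nat.succ_le_succ (F.dep_le_of_mem_T (Finset.mem_filter.mp hz).2)
  have hle' : ∀ y, (F.kids y).card < k → h y ≤ F.dep y := fun y hy => Finset.sup_le fun z hz => by
    obtain ⟨hzQ, hyz⟩ := Finset.mem_filter.mp hz
    have h1 := hfull z hzQ
    by_cases hy1 : F.dep y = 1
    · have h2 := F.card_kids_root hy1
      omega
    · obtain ⟨a, ha⟩ := F.exists_parent hy1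
      rcases (F.mem_T_kid ha).mp hyz with rfl | h3
      · omega
      · have h4 := F.dep_le_of_mem_T h3
        have h5 := F.dep_kid ha
        omega
  have hlow := le_cost_of_potential (s := Function.update F.wiring v Q) (M := M)
    (v := v) (g := fun y => if y = v then 0 else F.dep y + 2 - h y)
    (by simp) (fun u => by have := F.dep_le u; split_ifs <;> omega) (by
      intro a b hb
      by_cases hbv : b = v
      · simp [hbv]
      rw [if_neg hbv]
      by_cases hav : a = v
      · subst hav
        rw [Function.update_self] at hb
        have := F.le_sup_self (fun z => F.dep z + 1) hb
        simp only [hh, if_true]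
        omega
      rw [Function.update_of_ne hav] at hb
      have ha := hle a
      rw [if_neg hav]
      rcases Finset.mem_union.mp hb with hb | hb
      · have h1 := F.dep_kid hb
        have h2 : h a ≤ h b := F.sup_le_of_mem_T _ hb
        omega
      · have h1 := F.P_root hb
        have h2 := F.P_card a
        have h3 := Finset.card_pos.mpr ⟨b, hb⟩
        have h4 := hle' a (by omega)
        omega)
  have hup := cost_le (s := F.wiring) (M := M) (v := v) (g := F.dep)
    fun u _ => F.connIn_of_leaf hv u
  refine hup.trans (le_trans ?_ hlow)
  have hq := F.sum_sup_le v Q fun z => F.dep z + 1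
  simp only [hv, Finset.notMem_empty, if_false] at hq
  have e1 := Finset.sum_congr (rfl : Finset.univ.filter (fun y => y ≠ v) = _) (fun y hy =>
    show F.dep y + 2 = (if y = v then 0 else F.dep y + 2 - h y) + h y by
    have hyv : y ≠ v := by simpa using hy
    have := hle y
    rw [if_neg hyv]
    omega)
  rw [Finset.sum_add_distrib, Finset.sum_add_distrib, Finset.sum_const, Finset.filter_ne',
    Finset.card_erase_of_mem (Finset.mem_univ _), Finset.card_univ, smul_eq_mul] at e1
  rw [Finset.filter_ne'] at hq ⊢
  simp only [hh] at e1 ⊢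
  omega

theorem stable {M : ℕ} (hL : 2 * L ≤ Fintype.card V) (hV : 2 ≤ Fintype.card V)
    (hM : Fintype.card V ^ 2 < M)
    (hdev : ∀ v, (F.kids v).card < k → ∀ Q : Finset V, v ∉ Q → Disjoint Q (F.kids v) →
      (F.kids v).card + Q.card ≤ k →
      ∑ z ∈ Q, F.dep z * F.wt v z ≤ ∑ r ∈ F.P v, F.wt v r ∨
      F.kids v = ∅ ∧ (∀ z ∈ Q, (F.kids z).card = k) ∧
        ∑ z ∈ Q, (F.dep z + 1) * F.wt v z ≤ 2 * (Fintype.card V - 1)) :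
    Stable k M F.wiring := by
  have hLM : L + 2 ≤ M := by nlinarith
  intro v t hvt ht
  by_cases hsub : F.kids v ⊆ t
  · by_cases hfull : (F.kids v).card = k
    · have h1 : F.kids v = t := Finset.eq_of_subset_of_card_le hsub (by omega)
      have h2 : F.P v = ∅ := by
        rw [← Finset.card_eq_zero]
        have := F.P_card v
        omega
      have h3 : Function.update F.wiring v t = F.wiring := by
        rw [← h1, show F.kids v = F.wiring v by simp [wiring, h2], Function.update_eq_self]
      rw [h3]
    · have hlt := lt_of_le_of_ne (F.card_kids_le v) hfull
      have ht' : t = F.kids v ∪ (t \ F.kids v) := (Finset.union_sdiff_of_subset hsub).symm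
      have hcard := Finset.card_sdiff_add_card_eq_card hsub
      rcases hdev v hlt (t \ F.kids v) (fun h => hvt (Finset.mem_sdiff.mp h).1)
        Finset.sdiff_disjoint (by omega) with h | ⟨h1, h2, h3⟩
      · rw [ht']
        exact F.cost_le_update_of_wt hLM hlt h
      · rw [h1, Finset.sdiff_empty] at h2 h3
        exact F.cost_le_update_of_full hLM h1 h2 h3
  · obtain ⟨c, hc, hct⟩ := Finset.not_subset.mp hsub
    have hcv : c ≠ v := by
      rintro rfl
      have := F.dep_kid hc
      omega
    refine le_trans ?_ (penalty_le_cost (u := c) hcv fun a ha => ?_)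
    · refine (cost_le (g := fun _ => 2 * L - 1) fun u _ => F.connIn_two_mul v u).trans ?_
      rw [Finset.sum_const, smul_eq_mul]
      have h1 : (Finset.univ.filter fun u => u ≠ v).card ≤ Fintype.card V :=
        Finset.card_filter_le _ _
      have h2 := Nat.mul_le_mul h1 (show 2 * L - 1 ≤ Fintype.card V by omega)
      nlinarith
    · by_cases hav : a = v
      · subst hav
        rw [Function.update_self] at ha
        exact hct ha
      · rw [Function.update_of_ne hav] at ha
        rcases Finset.mem_union.mp ha with h | h
        · exact hav (F.parent_unique h hc)
        · have h1 := F.P_root h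
          have h2 := F.dep_kid hc
          have h3 := F.dep_pos v
          omega

theorem sum_cost_le {M : ℕ} (hL : 1 ≤ L) (hV : 1 ≤ Fintype.card V)
    (hleaf : ∀ v, F.kids v = ∅ → L ≤ F.dep v + 1) {C : ℕ} (hC : ∑ y, F.dep y = C + L)
    (hI : (Finset.univ.filter fun v => F.kids v ≠ ∅).card * (L - 1) + 1 ≤ C) :
    ∑ v, cost F.wiring M v ≤ 2 * (Fintype.card V * C) := by
  have hsplit : ∀ v, ∑ u ∈ Finset.univ.filter (fun u => u ≠ v), F.dep u + F.dep v = C + L := by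
    intro v
    rw [Finset.filter_ne', ← hC]
    exact Finset.sum_erase_add _ _ (Finset.mem_univ v)
  have hv : ∀ v, cost F.wiring M v ≤
      C + 1 + if F.kids v ≠ ∅ then Fintype.card V * (L - 1) else 0 := by
    intro v
    have hs := hsplit v
    have hp := F.dep_pos v
    split_ifs with h
    · refine (cost_le (g := fun u => L - F.dep v + F.dep u) fun u _ => F.connIn_depth v u).trans ?_
      rw [Finset.sum_add_distrib, Finset.sum_const, Finset.filter_ne',
        Finset.card_erase_of_mem (Finset.mem_univ _), Finset.card_univ, smul_eq_mul]
      rw [Finset.filter_ne'] at hs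
      have h1 : (Fintype.card V - 1) * (L - F.dep v) ≤ (Fintype.card V - 1) * (L - 1) :=
        Nat.mul_le_mul_left _ (by omega)
      obtain ⟨q, hq⟩ : ∃ q, Fintype.card V = q + 1 := ⟨_, (Nat.sub_add_cancel hV).symm⟩
      rw [hq] at h1 ⊢
      simp only [Nat.add_sub_cancel] at h1 ⊢
      rw [add_mul]
      omega
    · have h' : F.kids v = ∅ := not_not.mp h
      refine (cost_le (g := F.dep) fun u _ => F.connIn_of_leaf h' u).trans ?_
      have := hleaf v h'
      omega
  refine (Finset.sum_le_sum fun v _ => hv v).trans ?_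
  rw [Finset.sum_add_distrib, Finset.sum_const, Finset.card_univ, ← Finset.sum_filter,
    Finset.sum_const, smul_eq_mul, smul_eq_mul]
  nlinarith

/-- Replacing targets outside the roots by roots does not decrease the total weight. -/
theorem sum_le_of_exchange {R Q S : Finset V} {f : ℕ} {w : V → ℕ} {b : ℕ}
    (hmax : ∀ A ⊆ R, A.card ≤ f → ∑ r ∈ A, w r ≤ b) (hS : S ⊆ R) (hfS : f ≤ S.card)
    (hw : ∀ z ∈ Q, z ∉ R → ∀ r ∈ S, w z ≤ w r) (hQ : Q.card ≤ f) : ∑ z ∈ Q, w z ≤ b := by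
  obtain ⟨C, hC, hcard⟩ := Finset.exists_subset_card_eq (s := S \ (Q ∩ R)) (n := (Q \ R).card) (by
    have h1 := Finset.le_card_sdiff (Q ∩ R) S
    have h2 := Finset.card_sdiff_add_card_inter Q R
    omega)
  have hCR : C ⊆ S := hC.trans Finset.sdiff_subset
  have hd : Disjoint (Q ∩ R) C := Finset.disjoint_of_subset_right hC Finset.disjoint_sdiff
  have h3 := hmax ((Q ∩ R) ∪ C) (Finset.union_subset Finset.inter_subset_right (hCR.trans hS)) (by
    rw [Finset.card_union_of_disjoint hd]
    have h2 := Finset.card_sdiff_add_card_inter Q R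
    omega)
  rw [Finset.sum_union hd] at h3
  have h4 := Finset.sum_inter_add_sum_sdiff Q R w
  have h5 : ∑ z ∈ Q \ R, w z ≤ ∑ z ∈ C, w z := by
    let e := Finset.equivOfCardEq hcard.symm
    rw [← Finset.sum_coe_sort (Q \ R), ← Finset.sum_coe_sort C, ← e.sum_comp]
    refine Finset.sum_le_sum fun x _ => ?_
    obtain ⟨h6, h7⟩ := Finset.mem_sdiff.mp x.2
    exact hw x.1 h6 h7 _ (hCR (e x).2)
  omega

end Forest

/-! ### A concrete forest -/

/-- The nodes `(d, i)` with `1 ≤ d ≤ L` and `i < k ^ d`, where only the `i ∈ J` are kept at the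
last level `d = L`. -/
def nodes (k L : ℕ) (J : Finset ℕ) : Finset (ℕ × ℕ) :=
  (Finset.Icc 1 L ×ˢ Finset.range (k ^ L)).filter
    fun p => p.2 < k ^ p.1 ∧ (p.1 = L → p.2 ∈ J)

/-- The number of elements of `J` congruent to `i` modulo `k ^ d`. -/
def cnt (k : ℕ) (J : Finset ℕ) (d i : ℕ) : ℕ := (J.filter fun j => j % k ^ d = i).card

section Nodes

variable {k L : ℕ} {J : Finset ℕ}

theorem mem_nodes (hk : 1 ≤ k) {p : ℕ × ℕ} :
    p ∈ nodes k L J ↔ (1 ≤ p.1 ∧ p.1 ≤ L) ∧ p.2 < k ^ p.1 ∧ (p.1 = L → p.2 ∈ J) := by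
  simp only [nodes, Finset.mem_filter, Finset.mem_product, Finset.mem_Icc, Finset.mem_range]
  constructor
  · tauto
  · rintro ⟨h1, h2, h3⟩
    exact ⟨⟨h1, h2.trans_le (Nat.pow_le_pow_right hk h1.2)⟩, h2, h3⟩

theorem card_filter_range_pow (hk : 1 ≤ k) (d q i : ℕ) (hi : i < k ^ d) :
    ((Finset.range (k ^ (d + q))).filter fun j => j % k ^ d = i).card = k ^ q := by
  have hd : 0 < k ^ d := Nat.pow_pos hk
  have : (Finset.range (k ^ (d + q))).filter (fun j => j % k ^ d = i) =
      (Finset.range (k ^ q)).image fun x => i + k ^ d * x := by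
    ext j
    simp only [Finset.mem_filter, Finset.mem_range, Finset.mem_image]
    constructor
    · rintro ⟨h1, h2⟩
      refine ⟨j / k ^ d, ?_, by rw [← h2]; exact Nat.mod_add_div j (k ^ d)⟩
      rw [pow_add] at h1
      exact Nat.div_lt_of_lt_mul h1
    · rintro ⟨x, hx, rfl⟩
      refine ⟨?_, by rw [Nat.add_mul_mod_self_left, Nat.mod_eq_of_lt hi]⟩
      rw [pow_add]
      calc i + k ^ d * x < k ^ d + k ^ d * x := by omega
        _ = k ^ d * (x + 1) := by ring
        _ ≤ _ := Nat.mul_le_mul_left _ hx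
  rw [this, Finset.card_image_of_injective, Finset.card_range]
  intro a b hab
  have : k ^ d * a = k ^ d * b := by simpa using hab
  exact Nat.eq_of_mul_eq_mul_left hd this

theorem card_level_lt (hk : 1 ≤ k) {d e i : ℕ} (h1 : 1 ≤ e) (hde : d ≤ e) (heL : e < L)
    (hi : i < k ^ d) :
    (Finset.univ.filter fun y : ↥(nodes k L J) => y.1.1 = e ∧ y.1.2 % k ^ d = i).card =
      k ^ (e - d) := by
  obtain ⟨q, rfl⟩ := Nat.exists_eq_add_of_le hde
  rw [Nat.add_sub_cancel_left, ← card_filter_range_pow hk d q i hi]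
  refine Finset.card_bij (fun y _ => y.1.2) ?_ ?_ ?_
  · intro y hy
    obtain ⟨h3, h4⟩ := (Finset.mem_filter.mp hy).2
    have := ((mem_nodes hk).mp y.2).2.1
    rw [h3] at this
    simp [h4, this]
  · intro y hy y' hy' h
    exact Subtype.ext (Prod.ext ((Finset.mem_filter.mp hy).2.1.trans
      (Finset.mem_filter.mp hy').2.1.symm) h)
  · intro j hj
    simp only [Finset.mem_filter, Finset.mem_range] at hj
    exact ⟨⟨(d + q, j), (mem_nodes hk).mpr ⟨⟨h1, heL.le⟩, hj.1, fun h => absurd h heL.ne⟩⟩,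
      by simp [hj.2], rfl⟩

theorem card_level_last (hk : 1 ≤ k) (hL : 1 ≤ L) (hJ : J ⊆ Finset.range (k ^ L)) (d i : ℕ) :
    (Finset.univ.filter fun y : ↥(nodes k L J) => y.1.1 = L ∧ y.1.2 % k ^ d = i).card =
      cnt k J d i := by
  refine Finset.card_bij (fun y _ => y.1.2) ?_ ?_ ?_
  · intro y hy
    obtain ⟨h3, h4⟩ := (Finset.mem_filter.mp hy).2
    have := ((mem_nodes hk).mp y.2).2.2 h3
    simp [h4, this]
  · intro y hy y' hy' h
    exact Subtype.ext (Prod.ext ((Finset.mem_filter.mp hy).2.1.trans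
      (Finset.mem_filter.mp hy').2.1.symm) h)
  · intro j hj
    simp only [Finset.mem_filter] at hj
    exact ⟨⟨(L, j), (mem_nodes hk).mpr ⟨⟨hL, le_rfl⟩, by simpa using hJ hj.1, fun _ => hj.1⟩⟩,
      by simp [hj.2], rfl⟩

theorem sum_fiber_dep (hk : 1 ≤ k) (hJ : J ⊆ Finset.range (k ^ L)) {d i : ℕ} (hd : 1 ≤ d)
    (hdL : d ≤ L) {d' : ℕ} (hd' : d' ≤ d) (hi : i < k ^ d') (f : ℕ → ℕ) :
    ∑ y ∈ Finset.univ.filter (fun y : ↥(nodes k L J) => d ≤ y.1.1 ∧ y.1.2 % k ^ d' = i), f y.1.1 =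
      ∑ e ∈ Finset.Ico d L, k ^ (e - d') * f e + cnt k J d' i * f L := by
  rw [← Finset.sum_fiberwise_of_maps_to (g := fun y : ↥(nodes k L J) => y.1.1)
    (t := Finset.Icc d L)]
  · rw [← Finset.Ico_insert_right hdL, Finset.sum_insert (by simp), add_comm]
    have key : ∀ e, d ≤ e → ∑ y ∈ Finset.univ.filter (fun y : ↥(nodes k L J) =>
        d ≤ y.1.1 ∧ y.1.2 % k ^ d' = i) with y.1.1 = e, f y.1.1 =
        (Finset.univ.filter fun y : ↥(nodes k L J) => y.1.1 = e ∧ y.1.2 % k ^ d' = i).card *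
          f e := by
      intro e he
      rw [Finset.filter_filter, ← smul_eq_mul, ← Finset.sum_const]
      refine Finset.sum_congr ?_ ?_
      · ext y
        simp only [Finset.mem_filter, Finset.mem_univ, true_and]
        constructor
        · tauto
        · rintro ⟨h1, h2⟩
          exact ⟨⟨by omega, h2⟩, h1⟩
      · intro y hy
        rw [(Finset.mem_filter.mp hy).2.1]
    congr 1
    · refine Finset.sum_congr rfl fun e he => ?_
      obtain ⟨h1, h2⟩ := Finset.mem_Ico.mp he
      rw [key e h1, card_level_lt hk (by omega) (by omega) h2 hi]
    · rw [key L hdL, card_level_last hk (by omega) hJ]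
  · intro y hy
    have h1 := ((mem_nodes hk).mp y.2).1.2
    have h2 := (Finset.mem_filter.mp hy).2.1
    simp [h1, h2]

theorem card_nodes (hk : 1 ≤ k) (hL : 1 ≤ L) (hJ : J ⊆ Finset.range (k ^ L)) :
    Fintype.card ↥(nodes k L J) = ∑ e ∈ Finset.Ico 1 L, k ^ e + J.card := by
  have h := sum_fiber_dep (d := 1) (d' := 0) (i := 0) hk hJ le_rfl hL (by omega) (by simp)
    fun _ => 1
  simp only [pow_zero, Nat.mod_one, and_true, Finset.sum_const, smul_eq_mul, mul_one, cnt,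
    Finset.filter_true, Nat.sub_zero] at h
  rw [← h, Finset.filter_true_of_mem, Finset.card_univ]
  intro y _
  exact ((mem_nodes hk).mp y.2).1.1

theorem sum_dep_nodes (hk : 1 ≤ k) (hL : 1 ≤ L) (hJ : J ⊆ Finset.range (k ^ L)) :
    ∑ y : ↥(nodes k L J), y.1.1 = ∑ e ∈ Finset.Ico 1 L, k ^ e * e + J.card * L := by
  have h := sum_fiber_dep (d := 1) (d' := 0) (i := 0) hk hJ le_rfl hL (by omega) (by simp)
    fun e => e
  simp only [pow_zero, Nat.mod_one, and_true, cnt, Finset.filter_true, Nat.sub_zero] at h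
  rw [← h, Finset.filter_true_of_mem]
  intro y _
  exact ((mem_nodes hk).mp y.2).1.1

/-- The forest on `nodes k L J` in which the parent of `(d + 1, i)` is `(d, i % k ^ d)`. -/
theorem exists_forest (hk : 2 ≤ k) (hL : 3 ≤ L) :
    ∃ F : Forest ↥(nodes k L J) k L, (∀ v, F.dep v = v.1.1) ∧
      (∀ a b, b ∈ F.kids a ↔ b.1.1 = a.1.1 + 1 ∧ b.1.2 % k ^ a.1.1 = a.1.2) ∧
      (∀ y z, y ∈ F.T z ↔ z.1.1 ≤ y.1.1 ∧ y.1.2 % k ^ z.1.1 = z.1.2) ∧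
      ∀ v, ∀ A : Finset ↥(nodes k L J), (∀ r ∈ A, r.1.1 = 1) → (F.kids v).card + A.card ≤ k →
        ∑ r ∈ A, F.wt v r ≤ ∑ r ∈ F.P v, F.wt v r := by
  have hk1 : 1 ≤ k := by omega
  let R : Finset ↥(nodes k L J) := Finset.univ.filter fun v => v.1.1 = 1
  let kids : ↥(nodes k L J) → Finset ↥(nodes k L J) := fun a =>
    Finset.univ.filter fun b => b.1.1 = a.1.1 + 1 ∧ b.1.2 % k ^ a.1.1 = a.1.2
  let T : ↥(nodes k L J) → Finset ↥(nodes k L J) := fun z =>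
    Finset.univ.filter fun y => z.1.1 ≤ y.1.1 ∧ y.1.2 % k ^ z.1.1 = z.1.2
  have hmem := fun v : ↥(nodes k L J) => (mem_nodes hk1).mp v.2
  have hkids : ∀ a b, b ∈ kids a ↔ b.1.1 = a.1.1 + 1 ∧ b.1.2 % k ^ a.1.1 = a.1.2 := by
    simp [kids]
  have hT : ∀ y z, y ∈ T z ↔ z.1.1 ≤ y.1.1 ∧ y.1.2 % k ^ z.1.1 = z.1.2 := by simp [T]
  have hfull : ∀ a : ↥(nodes k L J), a.1.1 + 1 < L → (kids a).card = k := by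
    intro a ha
    have := card_level_lt (J := J) hk1 (d := a.1.1) (e := a.1.1 + 1) (i := a.1.2) (by omega)
      (by omega) ha (hmem a).2.1
    rw [Nat.add_sub_cancel_left, pow_one] at this
    exact this
  have hR : R.card = k := by
    have := card_level_lt (L := L) (J := J) hk1 (d := 0) (e := 1) (i := 0) (by omega) (by omega)
      (by omega) (by simp)
    rw [Nat.sub_zero, pow_one] at this
    exact (congrArg Finset.card (Finset.filter_congr fun y _ => by simp [Nat.mod_one])).trans this
  have hle : ∀ a, (kids a).card ≤ k := by
    intro a
    calc (kids a).card ≤ (Finset.range k).card := by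
          refine Finset.card_le_card_of_injOn (fun b => b.1.2 / k ^ a.1.1) ?_ ?_
          · intro b hb
            obtain ⟨h1, h2⟩ := (hkids a b).mp hb
            have h3 := (hmem b).2.1
            rw [h1, pow_succ] at h3
            simpa using Nat.div_lt_of_lt_mul h3
          · intro b hb b' hb' h
            obtain ⟨h1, h2⟩ := (hkids a b).mp hb
            obtain ⟨h1', h2'⟩ := (hkids a b').mp hb'
            refine Subtype.ext (Prod.ext (h1.trans h1'.symm) ?_)
            rw [← Nat.mod_add_div b.1.2 (k ^ a.1.1), ← Nat.mod_add_div b'.1.2 (k ^ a.1.1), h2, h2',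
              show b.1.2 / k ^ a.1.1 = b'.1.2 / k ^ a.1.1 from h]
      _ = k := by simp
  have hP : ∀ v, ∃ P ⊆ R, (kids v).card + P.card ≤ k ∧ (kids v = ∅ → P = R) ∧
      ∀ A ⊆ R, (kids v).card + A.card ≤ k →
        ∑ r ∈ A, (T r \ insert v (kids v)).card ≤ ∑ r ∈ P, (T r \ insert v (kids v)).card := by
    intro v
    by_cases hv : kids v = ∅
    · exact ⟨R, subset_rfl, by simp [hv, hR], fun _ => rfl, fun A hA _ =>
        Finset.sum_le_sum_of_subset hA⟩
    · obtain ⟨P, hP, hmax⟩ := Finset.exists_max_image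
        (R.powerset.filter fun A => (kids v).card + A.card ≤ k)
        (fun A => ∑ r ∈ A, (T r \ insert v (kids v)).card)
        ⟨∅, by simpa using hle v⟩
      simp only [Finset.mem_filter, Finset.mem_powerset] at hP hmax
      exact ⟨P, hP.1, hP.2, fun h => absurd h hv, fun A hA hAk => hmax A ⟨hA, hAk⟩⟩
  choose P hPR hPc hPl hPm using hP
  refine ⟨⟨fun v => v.1.1, kids, T, P, fun v => (hmem v).1.1, fun v => (hmem v).1.2,
    fun {a b} h => ((hkids a b).mp h).1, ?_, ?_, ?_, ?_, hle,
    fun {v} hv => hfull v (by omega), hR, ?_, ?_, hPc, ?_⟩, fun _ => rfl, hkids, hT, ?_⟩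
  · intro b hb
    have h1 := (hmem b).1
    obtain ⟨e, he⟩ : ∃ e, b.1.1 = e + 1 := ⟨b.1.1 - 1, by omega⟩
    refine ⟨⟨(e, b.1.2 % k ^ e), (mem_nodes hk1).mpr ⟨⟨by dsimp only; omega, by dsimp only; omega⟩,
      Nat.mod_lt _ (Nat.pow_pos hk1), fun h => ?_⟩⟩, (hkids _ _).mpr ⟨he, rfl⟩⟩
    dsimp only at h
    omega
  · intro a a' b h h'
    obtain ⟨h1, h2⟩ := (hkids a b).mp h
    obtain ⟨h1', h2'⟩ := (hkids a' b).mp h'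
    have h3 : a.1.1 = a'.1.1 := by omega
    refine Subtype.ext (Prod.ext h3 ?_)
    rw [← h2, ← h2', h3]
  · intro r z hr
    rw [hT]
    have hz := (hmem z).1.1
    have hr2 := (hmem r).2.1
    rw [show r.1.1 = 1 from hr] at hr2 ⊢
    constructor
    · rintro ⟨h1, h2⟩
      have h3 : z.1.1 = 1 := by omega
      rw [h3, Nat.mod_eq_of_lt hr2] at h2
      exact Subtype.ext (Prod.ext (h3.trans hr.symm) h2.symm)
    · rintro rfl
      exact ⟨hr.le, by rw [show z.1.1 = 1 from hr, Nat.mod_eq_of_lt hr2]⟩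
  · intro a b z h
    obtain ⟨h1, h2⟩ := (hkids a b).mp h
    rw [hT, hT]
    constructor
    · rintro ⟨h3, h4⟩
      by_cases h5 : z.1.1 = b.1.1
      · left
        rw [h5, Nat.mod_eq_of_lt (hmem b).2.1] at h4
        exact Subtype.ext (Prod.ext h5 h4.symm)
      · right
        have h6 : z.1.1 ≤ a.1.1 := by omega
        refine ⟨h6, ?_⟩
        rw [← h2, Nat.mod_mod_of_dvd _ (pow_dvd_pow k h6), h4]
    · rintro (rfl | ⟨h3, h4⟩)
      · exact ⟨le_rfl, Nat.mod_eq_of_lt (hmem z).2.1⟩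
      · refine ⟨by omega, ?_⟩
        rw [← h2, Nat.mod_mod_of_dvd _ (pow_dvd_pow k h3)] at h4
        exact h4
  · intro a b ha hb
    refine Finset.eq_empty_of_forall_notMem fun c hc => ?_
    have h1 := ((hkids a b).mp hb).1
    have h2 := ((hkids b c).mp hc).1
    have h3 := (hmem c).1.2
    have := hfull a (by omega)
    omega
  · intro v r hr
    exact (Finset.mem_filter.mp (hPR v hr)).2
  · intro v r hv hr
    rw [hPl v hv]
    exact Finset.mem_filter.mpr ⟨Finset.mem_univ _, hr⟩
  · intro v A hA hc
    exact hPm v A (fun r hr => Finset.mem_filter.mpr ⟨Finset.mem_univ _, hA r hr⟩) hc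

end Nodes

section Nodes

variable {k L : ℕ} {J : Finset ℕ}

theorem geom_eq (k i : ℕ) : geom k i = 1 + ∑ e ∈ Finset.range i, k ^ (e + 1) := by
  rw [geom, Finset.sum_range_succ', pow_zero, add_comm]

theorem costBound_eq (k L m : ℕ) (hm : 1 ≤ m) :
    costBound k (∑ e ∈ Finset.range L, k ^ (e + 1) + m) (L + 1) + (L + 1) =
      ∑ e ∈ Finset.range L, k ^ (e + 1) * (e + 1) + m * (L + 1) := by
  induction L generalizing m with
  | zero => simp [costBound, geom]; omega
  | succ L ih =>
    have h := ih (k ^ (L + 1) + m) (by omega)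
    rw [costBound] at h ⊢
    rw [Finset.sum_range_succ _ (L + 1), Finset.sum_range_succ _ L,
      geom_eq k (L + 1), Finset.sum_range_succ _ L, Finset.sum_range_succ _ L, add_assoc _ _ m]
    have e2 : k ^ (L + 1) * (L + 1) + m * (L + 1 + 1) = (k ^ (L + 1) + m) * (L + 1) + m := by ring
    rw [Finset.sum_range_succ _ L] at h
    omega

theorem sum_pow_add_two_le (hk : 2 ≤ k) (q : ℕ) :
    ∑ e ∈ Finset.range q, k ^ (e + 1) + 2 ≤ k ^ (q + 1) := by
  induction q with
  | zero => simpa using hk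
  | succ q ih =>
    rw [Finset.sum_range_succ]
    have : 2 * k ^ (q + 1) ≤ k ^ (q + 1 + 1) := by
      rw [pow_succ k (q + 1), mul_comm]; exact Nat.mul_le_mul_left _ hk
    omega

theorem card_filter_dep_le (hk : 1 ≤ k) {q : ℕ} (hq : q < L) :
    (Finset.univ.filter fun y : ↥(nodes k L J) => y.1.1 ≤ q).card =
      ∑ e ∈ Finset.range q, k ^ (e + 1) := by
  rw [Finset.card_eq_sum_card_fiberwise (f := fun y : ↥(nodes k L J) => y.1.1 - 1)
    (t := Finset.range q)]
  · refine Finset.sum_congr rfl fun e he => ?_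
    have h1 := card_level_lt (L := L) (J := J) hk (d := 0) (e := e + 1) (i := 0) (by omega)
      (by omega) (by have := Finset.mem_range.mp he; omega) (by simp)
    rw [Nat.sub_zero] at h1
    rw [← h1, Finset.filter_filter]
    refine congrArg Finset.card (Finset.filter_congr fun y _ => ?_)
    have h2 := ((mem_nodes hk).mp y.2).1
    have := Finset.mem_range.mp he
    simp only [pow_zero, Nat.mod_one, and_true]
    omega
  · intro y hy
    have h1 := (Finset.mem_filter.mp hy).2
    have h2 := ((mem_nodes hk).mp y.2).1
    simp only [Finset.coe_range, Set.mem_Iio]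
    omega

/-- A forest wiring on `nodes k L J` with no profitable deviation of the relevant kind meets all
requirements of the main theorem. -/
theorem good_nodes (hk : 2 ≤ k) (hL : 3 ≤ L) (hJ : J ⊆ Finset.range (k ^ L)) (hm : 1 ≤ J.card)
    {M : ℕ} (hM : Fintype.card ↥(nodes k L J) ^ 2 < M) (F : Forest ↥(nodes k L J) k L)
    (hdep : ∀ v, F.dep v = v.1.1)
    (hkids : ∀ a b, b ∈ F.kids a ↔ b.1.1 = a.1.1 + 1 ∧ b.1.2 % k ^ a.1.1 = a.1.2)
    (hdev : ∀ v, (F.kids v).card < k → ∀ Q : Finset ↥(nodes k L J), v ∉ Q →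
      Disjoint Q (F.kids v) → (F.kids v).card + Q.card ≤ k →
      ∑ z ∈ Q, F.dep z * F.wt v z ≤ ∑ r ∈ F.P v, F.wt v r ∨
      F.kids v = ∅ ∧ (∀ z ∈ Q, (F.kids z).card = k) ∧
        ∑ z ∈ Q, (F.dep z + 1) * F.wt v z ≤ 2 * (Fintype.card ↥(nodes k L J) - 1)) :
    Good ↥(nodes k L J) k M := by
  have hk1 : 1 ≤ k := by omega
  obtain ⟨q, rfl⟩ : ∃ q, L = q + 2 := ⟨L - 2, by omega⟩
  set N := ∑ e ∈ Finset.range q, k ^ (e + 1) with hN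
  have hcard := card_nodes hk1 (by omega) hJ
  have hsum := sum_dep_nodes hk1 (by omega) hJ
  rw [Finset.sum_Ico_eq_sum_range, show q + 2 - 1 = q + 1 by omega] at hcard hsum
  simp_rw [add_comm 1] at hcard hsum
  have hpow := sum_pow_add_two_le hk q
  have hC := costBound_eq k (q + 1) J.card hm
  rw [← hcard, show q + 1 + 1 = q + 2 by omega, ← hsum] at hC
  have hlow : 2 * (q + 2) ≤ Fintype.card ↥(nodes k (q + 2) J) := by
    have h1 : ∀ x, 1 ≤ x → 2 * x + 3 ≤ ∑ e ∈ Finset.range x, k ^ (e + 1) + k ^ (x + 1) := by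
      intro x hx
      induction x, hx using Nat.le_induction with
      | base => simp; nlinarith
      | succ x _ ih =>
        rw [Finset.sum_range_succ]
        have : 4 ≤ k ^ (x + 1 + 1) := by
          calc 4 = 2 ^ 2 := rfl
            _ ≤ k ^ 2 := Nat.pow_le_pow_left hk 2
            _ ≤ _ := Nat.pow_le_pow_right hk1 (by omega)
        omega
    have h2 := h1 q (by omega)
    rw [hcard, Finset.sum_range_succ]
    omega
  have hstab := F.stable hlow (by omega) hM hdev
  have hclog : q + 2 ≤ Nat.clog k (Fintype.card ↥(nodes k (q + 2) J)) := by
    rw [Nat.succ_le_iff, Nat.lt_clog_iff_pow_lt hk, hcard, Finset.sum_range_succ]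
    omega
  refine ⟨F.wiring, F.isWiring, hstab, fun v u => ?_, q + 2, by nlinarith, ?_⟩
  · exact (distW_le (F.connIn_two_mul v u)).trans (by omega)
  refine F.sum_cost_le (by omega) (by omega) (fun v hv => ?_) ?_ ?_
  · rw [hdep]
    by_contra hlt
    have h1 := card_level_lt (J := J) (L := q + 2) hk1 (d := v.1.1) (e := v.1.1 + 1) (i := v.1.2)
      (by omega) (by omega) (by omega) ((mem_nodes hk1).mp v.2).2.1
    have h2 := Nat.pow_pos (n := v.1.1 + 1 - v.1.1) hk1
    rw [← h1] at h2
    obtain ⟨b, hb⟩ := Finset.card_pos.mp h2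
    have h3 := (hkids v b).mpr (Finset.mem_filter.mp hb).2
    simp [hv] at h3
  · simp_rw [hdep]
    omega
  · have hI : (Finset.univ.filter fun v => F.kids v ≠ ∅).card ≤ N + J.card := by
      have h1 := card_filter_dep_le (J := J) (L := q + 2) hk1 (q := q) (by omega)
      have h2 := card_level_last (J := J) (L := q + 2) hk1 (by omega) hJ 0 0
      have h3 : cnt k J 0 0 = J.card := by simp [cnt, Nat.mod_one]
      rw [hN, ← h1, ← h3, ← h2]
      have h4 : (Finset.univ.filter fun v => F.kids v ≠ ∅) ⊆
          (Finset.univ.filter fun y : ↥(nodes k (q + 2) J) => y.1.1 ≤ q) ∪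
          (Finset.univ.filter fun v => F.kids v ≠ ∅ ∧ v.1.1 = q + 1) := by
        intro v hv
        have h5 := (Finset.mem_filter.mp hv).2
        obtain ⟨b, hb⟩ := Finset.nonempty_iff_ne_empty.mpr h5
        have h6 := F.dep_kid hb
        have h7 := F.dep_le b
        rw [hdep] at h6 h7
        rw [hdep] at h6
        simp only [Finset.mem_union, Finset.mem_filter, Finset.mem_univ, true_and]
        by_cases h8 : v.1.1 ≤ q
        · exact Or.inl h8
        · exact Or.inr ⟨h5, by omega⟩
      refine (Finset.card_le_card h4).trans ((Finset.card_union_le _ _).trans ?_)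
      refine Nat.add_le_add_left ?_ _
      have h9 : ∀ v, ∃ b, F.kids v ≠ ∅ → b ∈ F.kids v := fun v => by
        by_cases h : F.kids v = ∅
        · exact ⟨v, fun h' => absurd h h'⟩
        · obtain ⟨b, hb⟩ := Finset.nonempty_iff_ne_empty.mpr h
          exact ⟨b, fun _ => hb⟩
      choose g hg using h9
      refine Finset.card_le_card_of_injOn g ?_ ?_
      · intro v hv
        obtain ⟨h10, h11⟩ := (Finset.mem_filter.mp hv).2
        have h12 := ((hkids v _).mp (hg v h10)).1
        simp [Nat.mod_one]
        omega
      · intro v hv v' hv' h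
        have h10 := hg v (Finset.mem_filter.mp hv).2.1
        have h11 := hg v' (Finset.mem_filter.mp hv').2.1
        have h : g v = g v' := h
        rw [h] at h10
        exact F.parent_unique h10 h11
    have hD : 2 ≤ ∑ e ∈ Finset.range q, k ^ (e + 1) * (e + 1) := by
      obtain ⟨p, rfl⟩ : ∃ p, q = p + 1 := ⟨q - 1, by omega⟩
      rw [Finset.sum_range_succ']
      simp only [zero_add, pow_one, mul_one]
      omega
    rw [Finset.sum_range_succ] at hsum
    have h1 := Nat.mul_le_mul_right (q + 1) hI
    have h2 := Nat.mul_le_mul_right (q + 1) hpow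
    rw [show q + 2 - 1 = q + 1 by omega]
    nlinarith

/-- The number of nodes at levels `d, …, L - 1` below a given node of level `d`. -/
def inner (k L d : ℕ) : ℕ := ∑ e ∈ Finset.range (L - d), k ^ e

theorem card_T (hk : 1 ≤ k) (hJ : J ⊆ Finset.range (k ^ L)) {F : Forest ↥(nodes k L J) k L}
    (hT : ∀ y z, y ∈ F.T z ↔ z.1.1 ≤ y.1.1 ∧ y.1.2 % k ^ z.1.1 = z.1.2) (z : ↥(nodes k L J)) :
    (F.T z).card = inner k L z.1.1 + cnt k J z.1.1 z.1.2 := by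
  obtain ⟨⟨h1, h2⟩, h3, -⟩ := (mem_nodes hk).mp z.2
  have h := sum_fiber_dep hk hJ h1 h2 le_rfl h3 fun _ => 1
  have h4 : F.T z = Finset.univ.filter fun y : ↥(nodes k L J) =>
      z.1.1 ≤ y.1.1 ∧ y.1.2 % k ^ z.1.1 = z.1.2 := by
    ext y
    simp [hT]
  rw [h4, Finset.card_eq_sum_ones, h, Finset.sum_Ico_eq_sum_range]
  simp [inner]

end Nodes

namespace Forest

variable {V : Type} [DecidableEq V] [Fintype V] {k L : ℕ} (F : Forest V k L)

theorem sum_le_of_le_root {v : V}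
    (hP : ∀ A : Finset V, (∀ r ∈ A, F.dep r = 1) → (F.kids v).card + A.card ≤ k →
      ∑ r ∈ A, F.wt v r ≤ ∑ r ∈ F.P v, F.wt v r)
    {Q : Finset V} (hQ : (F.kids v).card + Q.card ≤ k)
    (hD : ∀ z ∈ Q, ∀ r, F.dep z ≠ 1 → F.dep r = 1 → (F.kids v = ∅ ∨ v ∉ F.T r) →
      F.dep z * F.wt v z ≤ F.wt v r) :
    ∑ z ∈ Q, F.dep z * F.wt v z ≤ ∑ r ∈ F.P v, F.wt v r := by
  have hroots := F.card_roots
  set R := Finset.univ.filter fun v => F.dep v = 1 with hR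
  have hRm : ∀ r, r ∈ R ↔ F.dep r = 1 := by simp [hR]
  refine sum_le_of_exchange (R := R) (S := R.filter fun r => F.kids v = ∅ ∨ v ∉ F.T r)
    (f := k - (F.kids v).card) (w := fun z => F.dep z * F.wt v z) ?_ (Finset.filter_subset _ _) ?_
    ?_ (by omega)
  · intro A hA hf
    refine le_of_eq_of_le (Finset.sum_congr rfl fun r hr => ?_) (hP A ?_ ?_)
    · rw [(hRm r).mp (hA hr), one_mul]
    · exact fun r hr => (hRm r).mp (hA hr)
    · have := F.card_kids_le v
      omega
  · by_cases hv : F.kids v = ∅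
    · simp [hv, hroots]
    · have h1 := Finset.card_filter_add_card_filter_not (s := R)
        (p := fun r => F.kids v = ∅ ∨ v ∉ F.T r)
      have h2 : (R.filter fun r => ¬(F.kids v = ∅ ∨ v ∉ F.T r)).card ≤ 1 := by
        refine Finset.card_le_one.mpr fun a ha b hb => ?_
        simp only [Finset.mem_filter, hRm, hv, false_or, not_not] at ha hb
        exact F.root_unique ha.1 hb.1 ha.2 hb.2
      have h3 := Finset.card_pos.mpr (Finset.nonempty_iff_ne_empty.mpr hv)
      omega
  · intro z hz hzR r hr
    obtain ⟨h1, h2⟩ := Finset.mem_filter.mp hr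
    have h3 := (hRm r).mp h1
    simp only [h3, one_mul]
    exact hD z hz r (fun h => hzR ((hRm z).mpr h)) h3 h2

theorem wt_le (v z : V) : F.wt v z ≤ (F.T z).card := Finset.card_le_card Finset.sdiff_subset

theorem card_T_le_wt_of_leaf {v : V} (hv : F.kids v = ∅) (z : V) :
    (F.T z).card ≤ F.wt v z + 1 := by
  rw [wt, hv]
  have := Finset.le_card_sdiff (insert v ∅) (F.T z)
  have h2 := Finset.card_insert_le v (∅ : Finset V)
  simp only [Finset.card_empty] at h2
  omega

theorem wt_eq_of_notMem {v z : V} (hz : v ∉ F.T z) (hk : ∀ b ∈ F.kids v, b ≠ z) :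
    F.wt v z = (F.T z).card := by
  rw [wt]
  congr 1
  refine Finset.sdiff_eq_self_of_disjoint (Finset.disjoint_right.mpr fun y hy hyz => ?_)
  rcases Finset.mem_insert.mp hy with rfl | hy
  · exact hz hyz
  · rcases (F.mem_T_kid hy).mp hyz with h | h
    · exact hk y hy h.symm
    · exact hz h

theorem kid_ne_root {v r : V} (hr : F.dep r = 1) : ∀ b ∈ F.kids v, b ≠ r := by
  rintro b hb rfl
  have := F.dep_kid hb
  have := F.dep_pos v
  omega

theorem sum_le_of_mul_card_lt {v : V}
    (hP : ∀ A : Finset V, (∀ r ∈ A, F.dep r = 1) → (F.kids v).card + A.card ≤ k →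
      ∑ r ∈ A, F.wt v r ≤ ∑ r ∈ F.P v, F.wt v r)
    {Q : Finset V} (hQ : (F.kids v).card + Q.card ≤ k)
    (hD : ∀ z r, F.dep z ≠ 1 → F.dep r = 1 → F.dep z * (F.T z).card < (F.T r).card) :
    ∑ z ∈ Q, F.dep z * F.wt v z ≤ ∑ r ∈ F.P v, F.wt v r := by
  refine F.sum_le_of_le_root hP hQ fun z _ r hz hr hv => ?_
  have h1 := Nat.mul_le_mul_left (F.dep z) (F.wt_le v z)
  have h2 := hD z r hz hr
  rcases hv with hv | hv
  · have := F.card_T_le_wt_of_leaf hv r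
    omega
  · rw [F.wt_eq_of_notMem hv (F.kid_ne_root hr)]
    omega

end Forest

section Initial

variable {k L : ℕ}

theorem cnt_range (hk : 1 ≤ k) (m d i : ℕ) (hi : i < k ^ d) :
    cnt k (Finset.range m) d i = m / k ^ d + if i < m % k ^ d then 1 else 0 := by
  have h := Nat.count_modEq_card m (r := k ^ d) (Nat.pow_pos hk) i
  rw [Nat.count_eq_card_filter_range, Nat.mod_eq_of_lt hi] at h
  rw [← h, cnt]
  refine congrArg Finset.card (Finset.filter_congr fun j _ => ?_)
  rw [Nat.ModEq, Nat.mod_eq_of_lt hi]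

theorem cnt_range_le (hk : 1 ≤ k) (m d i : ℕ) (hi : i < k ^ d) :
    cnt k (Finset.range m) d i ≤ (m + k ^ d - 1) / k ^ d := by
  have hd : 0 < k ^ d := Nat.pow_pos hk
  rw [cnt_range hk m d i hi, Nat.le_div_iff_mul_le hd]
  generalize k ^ d = K at hd
  have := Nat.div_add_mod m K
  split_ifs with h
  · rw [add_mul, mul_comm (m / K)]; omega
  · rw [add_mul, mul_comm (m / K)]; omega

theorem inner_succ {d : ℕ} (hd : d < L) : inner k L d = 1 + k * inner k L (d + 1) := by
  rw [inner, inner, show L - d = L - (d + 1) + 1 by omega, Finset.sum_range_succ', pow_zero,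
    add_comm, Finset.mul_sum]
  simp_rw [pow_succ']

theorem depth_mul_le (hk : 3 ≤ k) (hL : 3 ≤ L) {m : ℕ} (hm : 1 ≤ m)
    (h : 4 ≤ k ∨ 4 ≤ L ∨ 3 ≤ m) {d : ℕ} (h2d : 2 ≤ d) (hdL : d ≤ L) :
    d * (inner k L d + (m + k ^ d - 1) / k ^ d) < inner k L 1 + m / k := by
  have hc : ∀ e, 1 ≤ (m + k ^ e - 1) / k ^ e := fun e => by
    have : 0 < k ^ e := Nat.pow_pos (by omega)
    rw [Nat.le_div_iff_mul_le this]
    omega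
  induction d, h2d using Nat.le_induction with
  | base =>
    rw [inner_succ (d := 1) (by omega)]
    have hB : 1 ≤ inner k L 2 := by rw [inner_succ (d := 2) (by omega)]; omega
    have h1 := hc 2
    have h3 : k * ((m + k ^ 2 - 1) / k ^ 2 - 1) ≤ m / k := by
      rw [Nat.le_div_iff_mul_le (by omega)]
      obtain ⟨c, hc⟩ := Nat.exists_eq_add_of_le' h1
      have h4 := Nat.div_mul_le_self (m + k ^ 2 - 1) (k ^ 2)
      rw [hc] at h4 ⊢
      simp only [Nat.add_sub_cancel]
      have : 0 < k ^ 2 := Nat.pow_pos (by omega)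
      have : k * c * k = c * k ^ 2 := by ring
      rw [add_mul] at h4
      omega
    obtain ⟨c, hc⟩ := Nat.exists_eq_add_of_le' h1
    obtain ⟨B, hB'⟩ := Nat.exists_eq_add_of_le' hB
    rw [hc, Nat.add_sub_cancel] at h3
    rw [hc, show 1 + 1 = 2 from rfl]
    rcases Nat.lt_or_ge 3 k with hk4 | hk3
    · rw [hB']
      have := Nat.mul_le_mul_right c hk4
      have := Nat.mul_le_mul_right (B + 1) hk4
      omega
    · obtain rfl : k = 3 := by omega
      rcases Nat.eq_zero_or_pos c with rfl | hc0
      · rcases h with h | h | h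
        · omega
        · have : 4 ≤ inner 3 L 2 := by
            rw [inner_succ (d := 2) (by omega), inner_succ (d := 3) (by omega)]; omega
          omega
        · omega
      · omega
  | succ d hd ih =>
    refine lt_of_le_of_lt ?_ (ih (by omega))
    rw [inner_succ (d := d) (by omega)]
    have h1 : k * ((m + k ^ (d + 1) - 1) / k ^ (d + 1)) ≤ (m + k ^ d - 1) / k ^ d + k - 1 := by
      have hd0 : 0 < k ^ d := Nat.pow_pos (by omega)
      have hd1 : 0 < k ^ (d + 1) := Nat.pow_pos (by omega)
      have e1 : (m + k ^ (d + 1) - 1) / k ^ (d + 1) = (((m + k ^ d - 1) / k ^ d) + k - 1) / k := by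
        have e2 : (m + k ^ d - 1) / k ^ d + k - 1 = (m + k ^ d - 1 + k ^ d * (k - 1)) / k ^ d := by
          rw [Nat.add_mul_div_left _ _ hd0]
          exact Nat.add_sub_assoc (by omega) _
        rw [e2, Nat.div_div_eq_div_mul, ← pow_succ]
        congr 1
        obtain ⟨k', rfl⟩ := Nat.exists_eq_add_of_le' (show 1 ≤ k by omega)
        rw [Nat.add_sub_cancel, pow_succ, mul_add]
        omega
      rw [e1]
      exact Nat.mul_div_le _ _
    have h2 := hc (d + 1)
    obtain ⟨c, hc'⟩ := Nat.exists_eq_add_of_le' h2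
    rw [hc'] at h1 ⊢
    set B := inner k L (d + 1)
    have h4 : 2 * (B + c) + 2 ≤ 1 + k * B + (m + k ^ d - 1) / k ^ d := by
      rw [mul_add] at h1
      have h6 : 2 * B ≤ k * B := Nat.mul_le_mul_right _ (by omega)
      have h7 : 2 * c ≤ k * c := Nat.mul_le_mul_right _ (by omega)
      generalize (m + k ^ d - 1) / k ^ d = C at h1 ⊢
      omega
    have h5 := Nat.mul_le_mul_left d h4
    refine le_trans ?_ h5
    have : (d + 1) * (B + c) ≤ d * (2 * (B + c)) := by
      rw [← mul_assoc]; exact Nat.mul_le_mul_right _ (by omega)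
    nlinarith

theorem good_nodes_of_three_le (hk : 3 ≤ k) (hL : 3 ≤ L) {m : ℕ} (hm : 1 ≤ m) (hmL : m ≤ k ^ L)
    (h : 4 ≤ k ∨ 4 ≤ L ∨ 3 ≤ m) {M : ℕ}
    (hM : Fintype.card ↥(nodes k L (Finset.range m)) ^ 2 < M) :
    Good ↥(nodes k L (Finset.range m)) k M := by
  have hk1 : 1 ≤ k := by omega
  have hJ : Finset.range m ⊆ Finset.range (k ^ L) := Finset.range_subset_range.mpr hmL
  obtain ⟨F, hdep, hkids, hT, hP⟩ := exists_forest (k := k) (L := L) (J := Finset.range m)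
    (by omega) hL
  refine good_nodes (by omega) hL hJ (by simpa using hm) hM F hdep hkids
    fun v hv Q _ _ hQ => Or.inl ?_
  refine F.sum_le_of_mul_card_lt (fun A hA => hP v A fun r hr => by rw [← hdep]; exact hA r hr) hQ
    fun z r hz hr => ?_
  rw [hdep] at hz hr ⊢
  have hzm := (mem_nodes hk1).mp z.2
  have hrm := ((mem_nodes hk1).mp r.2).2.1
  rw [card_T hk1 hJ hT, card_T hk1 hJ hT]
  rw [hr] at hrm ⊢
  have h1 := depth_mul_le hk hL hm h (d := z.1.1) (by omega) hzm.1.2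
  have h2 := Nat.mul_le_mul_left z.1.1
    (Nat.add_le_add_left (cnt_range_le hk1 m z.1.1 z.1.2 hzm.2.1) (inner k L z.1.1))
  have h3 := cnt_range hk1 m 1 r.1.2 hrm
  rw [pow_one] at h3
  omega

end Initial

namespace Forest

variable {V : Type} [DecidableEq V] [Fintype V] {k L : ℕ} (F : Forest V k L)

theorem sum_wt_P_le_card (v : V) : ∑ r ∈ F.P v, F.wt v r ≤ Fintype.card V - 1 := by
  refine (F.sum_wt_P_le v).trans ?_
  rw [← Finset.card_filter]
  refine (Finset.card_filter_le _ _).trans ?_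
  rw [Finset.filter_ne', Finset.card_erase_of_mem (Finset.mem_univ v), Finset.card_univ]

theorem card_le_sum_wt_of_leaf {v : V} (hv : F.kids v = ∅) :
    Fintype.card V - 1 ≤ ∑ r ∈ F.P v, F.wt v r := by
  rw [← Finset.card_univ, ← Finset.card_erase_of_mem (Finset.mem_univ v)]
  refine (Finset.card_le_card fun y hy => ?_).trans Finset.card_biUnion_le
  obtain ⟨r, hr, hyr⟩ := F.exists_root y
  refine Finset.mem_biUnion.mpr ⟨r, F.P_leaf hv hr, Finset.mem_sdiff.mpr ⟨hyr, ?_⟩⟩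
  simpa [hv] using Finset.ne_of_mem_erase hy

theorem sum_succ_le_of_leaf {v : V} (hv : F.kids v = ∅)
    (hP : ∀ A : Finset V, (∀ r ∈ A, F.dep r = 1) → (F.kids v).card + A.card ≤ k →
      ∑ r ∈ A, F.wt v r ≤ ∑ r ∈ F.P v, F.wt v r)
    {Q : Finset V} (hQ : Q.card ≤ k)
    (hD : ∀ z ∈ Q, ∀ r, F.dep z ≠ 1 → F.dep r = 1 →
      (F.dep z + 1) * (F.T z).card + 2 ≤ 2 * (F.T r).card) :
    ∑ z ∈ Q, (F.dep z + 1) * F.wt v z ≤ 2 * (Fintype.card V - 1) := by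
  have hroots := F.card_roots
  set R := Finset.univ.filter fun v => F.dep v = 1 with hR
  have hRm : ∀ r, r ∈ R ↔ F.dep r = 1 := by simp [hR]
  refine sum_le_of_exchange (R := R) (S := R) (f := k) (w := fun z => (F.dep z + 1) * F.wt v z)
    (fun A hA hf => ?_) subset_rfl hroots.ge (fun z hz hzR r hr => ?_) hQ
  · have h1 := (hP A (fun r hr => (hRm r).mp (hA hr)) (by simpa [hv] using hf)).trans
      (F.sum_wt_P_le_card v)
    refine le_trans (le_of_eq ?_) (Nat.mul_le_mul_left 2 h1)
    rw [Finset.mul_sum]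
    exact Finset.sum_congr rfl fun r hr => by rw [(hRm r).mp (hA hr)]
  · have h1 := hD z hz r (fun h => hzR ((hRm z).mpr h)) ((hRm r).mp hr)
    have h2 := F.card_T_le_wt_of_leaf hv r
    have h3 := Nat.mul_le_mul_left (F.dep z + 1) (F.wt_le v z)
    simp only [(hRm r).mp hr]
    omega

end Forest

section Binary

variable {l : ℕ} {J : Finset ℕ}

theorem inner_two (L d : ℕ) : inner 2 L d + 1 = 2 ^ (L - d) := by
  rw [inner]
  induction L - d with
  | zero => simp
  | succ q ih => rw [Finset.sum_range_succ, pow_succ]; omega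

theorem cnt_le {k L : ℕ} (hk : 1 ≤ k) (hJ : J ⊆ Finset.range (k ^ L)) {d : ℕ} (hd : d ≤ L) {i : ℕ}
    (hi : i < k ^ d) : cnt k J d i ≤ k ^ (L - d) := by
  have h := card_filter_range_pow hk d (L - d) i hi
  rw [Nat.add_sub_cancel' hd] at h
  rw [← h]
  exact Finset.card_le_card (Finset.filter_subset_filter _ hJ)

theorem mul_pow_le {l e : ℕ} (he : e + 1 ≤ l) : (e + 5) * 2 ^ (l - (e + 1) + 1) ≤ 8 * 2 ^ l := by
  obtain ⟨q, rfl⟩ := Nat.exists_eq_add_of_le he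
  have h : e + 5 ≤ 8 * 2 ^ e := by
    have := Nat.lt_two_pow_self (n := e)
    omega
  calc (e + 5) * 2 ^ (e + 1 + q - (e + 1) + 1) = (e + 5) * 2 ^ (q + 1) := by congr 2; omega
    _ ≤ 8 * 2 ^ e * 2 ^ (q + 1) := Nat.mul_le_mul_right _ h
    _ = 8 * 2 ^ (e + 1 + q) := by ring

theorem mul_pow_le' {l e : ℕ} (he : e + 1 ≤ l) : (e + 4) * 2 ^ (l - (e + 1) + 1) ≤ 4 * 2 ^ l := by
  obtain ⟨q, rfl⟩ := Nat.exists_eq_add_of_le he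
  have h : e + 4 ≤ 4 * 2 ^ e := by
    have := Nat.lt_two_pow_self (n := e)
    omega
  calc (e + 4) * 2 ^ (e + 1 + q - (e + 1) + 1) = (e + 4) * 2 ^ (q + 1) := by congr 2; omega
    _ ≤ 4 * 2 ^ e * 2 ^ (q + 1) := Nat.mul_le_mul_right _ h
    _ = 4 * 2 ^ (e + 1 + q) := by ring

/-- Numerical conditions on the distribution of the last level under which the binary forest on
`nodes 2 (l + 3) J` gives a stable wiring. -/
structure Balanced (l : ℕ) (J : Finset ℕ) : Prop where
  sub : J ⊆ Finset.range (2 ^ (l + 3))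
  partial_two : ∀ i < 2 ^ (l + 2), cnt 2 J (l + 2) i = 1 → ∀ z < 4,
    2 * cnt 2 J 2 z ≤ cnt 2 J 1 (1 - i % 2) + 1 ∨
      i % 4 = z ∧ 2 * cnt 2 J 2 z ≤ cnt 2 J 1 (1 - i % 2) + 5
  one : ∀ r < 2, cnt 2 J 1 r + 2 * (l + 3) ≤ 4 * 2 ^ l + J.card
  two : ∀ z < 4, 2 * cnt 2 J 2 z + 2 * (l + 3) ≤ 4 * 2 ^ l + J.card + 1
  two_one : ∀ z < 4, ∀ r < 2, 3 * cnt 2 J 2 z + 1 ≤ 2 * 2 ^ l + 2 * cnt 2 J 1 r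
  three_one : ∀ z < 8, ∀ r < 2, 3 * cnt 2 J 3 z ≤ 2 ^ l + 2 + cnt 2 J 1 r

theorem good_nodes_of_balanced (h : Balanced l J) (hm : 1 ≤ J.card) {M : ℕ}
    (hM : Fintype.card ↥(nodes 2 (l + 3) J) ^ 2 < M) : Good ↥(nodes 2 (l + 3) J) 2 M := by
  obtain ⟨F, hdep, hkids, hT, hP⟩ := exists_forest (k := 2) (L := l + 3) (J := J) le_rfl (by omega)
  refine good_nodes le_rfl (by omega) h.sub hm hM F hdep hkids fun v hv Q hvQ hdisj hQ => ?_
  have hmem := fun z : ↥(nodes 2 (l + 3) J) => (mem_nodes (by omega)).mp z.2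
  have hTc : ∀ z, (F.T z).card = inner 2 (l + 3) z.1.1 + cnt 2 J z.1.1 z.1.2 :=
    card_T (by omega) h.sub hT
  have hP' : ∀ A : Finset ↥(nodes 2 (l + 3) J), (∀ r ∈ A, F.dep r = 1) →
      (F.kids v).card + A.card ≤ 2 → ∑ r ∈ A, F.wt v r ≤ ∑ r ∈ F.P v, F.wt v r :=
    fun A hA => hP v A fun r hr => by rw [← hdep]; exact hA r hr
  have hcard := card_nodes (k := 2) (by omega) (by omega) h.sub
  have hin := inner_two (l + 3)
  have hin1 := hin 1
  have hin2 := hin 2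
  have hin3 := hin 3
  rw [show l + 3 - 1 = l + 2 by omega, pow_add] at hin1
  rw [show l + 3 - 2 = l + 1 by omega, pow_add] at hin2
  rw [show l + 3 - 3 = l by omega] at hin3
  have hn : Fintype.card ↥(nodes 2 (l + 3) J) + 2 = 8 * 2 ^ l + J.card := by
    have h1 : ∀ x, ∑ e ∈ Finset.Ico 1 (x + 1), 2 ^ e + 2 = 2 ^ (x + 1) := by
      intro x
      induction x with
      | zero => simp
      | succ x ih => rw [Finset.sum_Ico_succ_top (by omega), pow_succ 2 (x + 1)]; omega
    have h2 : ∑ e ∈ Finset.Ico 1 (l + 3), 2 ^ e + 2 = 2 ^ (l + 3) := h1 (l + 2)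
    have h3 : 2 ^ (l + 3) = 8 * 2 ^ l := by ring
    rw [hcard]
    omega
  have hlow : ∀ x : ↥(nodes 2 (l + 3) J), (F.kids x).card < 2 →
      (F.T x).card ≤ 2 ∧ ((F.T x).card ≤ 1 ∨ x.1.1 = l + 2 ∧ (F.kids x).card = 1 ∧
        cnt 2 J (l + 2) x.1.2 = 1) := by
    intro x hx
    obtain ⟨hx1, hx2, -⟩ := hmem x
    have hkx : F.kids x = Finset.univ.filter
        fun b => b.1.1 = x.1.1 + 1 ∧ b.1.2 % 2 ^ x.1.1 = x.1.2 := by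
      ext b; simp [hkids]
    rw [hTc]
    rcases Nat.lt_or_ge (x.1.1 + 1) (l + 3) with h1 | h1
    · have h2 := card_level_lt (J := J) (L := l + 3) (k := 2) (by omega) (d := x.1.1)
        (e := x.1.1 + 1) (i := x.1.2) (by omega) (by omega) h1 hx2
      rw [← hkx, Nat.add_sub_cancel_left] at h2
      omega
    · rcases h1.eq_or_lt with h3 | h3
      · have h4 : x.1.1 = l + 2 := by omega
        have h2 := card_level_last (k := 2) (by omega) (by omega) h.sub x.1.1 x.1.2
        have h5 := hin (l + 2)
        have h6 : F.kids x = Finset.univ.filter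
            fun b => b.1.1 = l + 3 ∧ b.1.2 % 2 ^ x.1.1 = x.1.2 := by
          rw [hkx]
          exact Finset.filter_congr fun b _ => by rw [← h3]
        rw [← h6] at h2
        rw [show l + 3 - (l + 2) = 1 by omega] at h5
        rw [h4] at h2 ⊢
        omega
      · have h4 : x.1.1 = l + 3 := by omega
        have h5 := hin (l + 3)
        rw [h4] at hx2
        have h6 := cnt_le (by omega) h.sub le_rfl hx2
        rw [Nat.sub_self] at h5 h6
        rw [h4]
        omega
  -- nodes of depth at least three
  have hdeep : ∀ z r : ↥(nodes 2 (l + 3) J), 3 ≤ z.1.1 → r.1.1 = 1 →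
      z.1.1 * (F.T z).card ≤ (F.T r).card ∧
        (z.1.1 + 1) * (F.T z).card + 2 ≤ 2 * (F.T r).card := by
    intro z r hz hr
    obtain ⟨hz1, hz2, -⟩ := hmem z
    have hr2 := (hmem r).2.1
    rw [hTc, hTc, hr]
    rw [hr] at hr2
    have hc := cnt_le (by omega) h.sub hz1.2 hz2
    rcases hz.eq_or_lt with h3 | h3
    · rw [← h3] at hz2 hc ⊢
      have := h.three_one _ hz2 _ hr2
      rw [show l + 3 - 3 = l by omega] at hc
      omega
    · obtain ⟨e, he⟩ := Nat.exists_eq_add_of_le h3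
      have he' : z.1.1 = e + 4 := by omega
      have h4 : inner 2 (l + 3) z.1.1 + cnt 2 J z.1.1 z.1.2 + 1 ≤ 2 ^ (l - (e + 1) + 1) := by
        have := hin z.1.1
        rw [pow_succ, show l - (e + 1) = l + 3 - z.1.1 by omega]
        omega
      have h5 := mul_pow_le (l := l) (e := e) (by omega)
      have h6 := mul_pow_le' (l := l) (e := e) (by omega)
      have h7 := Nat.mul_le_mul_left (e + 4) h4
      have h8 := Nat.mul_le_mul_left (e + 5) h4
      rw [he'] at h7 h8 ⊢
      rw [mul_add] at h7 h8
      rw [show e + 4 + 1 = e + 5 from rfl]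
      constructor <;> omega
  rcases Nat.eq_zero_or_pos (F.kids v).card with hv0 | hv1
  · have hv' := Finset.card_eq_zero.mp hv0
    by_cases hfull : ∀ z ∈ Q, (F.kids z).card = 2
    · refine Or.inr ⟨hv', hfull, F.sum_succ_le_of_leaf hv' hP' (by omega) fun z _ r hz hr => ?_⟩
      rw [hdep] at hz hr ⊢
      have hz1 := hmem z
      rcases Nat.lt_or_ge 2 z.1.1 with h3 | h3
      · exact (hdeep z r h3 hr).2
      · have h4 : z.1.1 = 2 := by omega
        have hr2 := (hmem r).2.1
        rw [hTc, hTc, hr, h4]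
        rw [hr] at hr2
        rw [h4] at hz1
        have := h.two_one _ hz1.2.1 _ hr2
        omega
    · left
      push Not at hfull
      obtain ⟨x, hxQ, hx⟩ := hfull
      refine le_trans ?_ (F.card_le_sum_wt_of_leaf hv')
      have hw : ∀ b, F.dep b * F.wt v b + 2 * (l + 2) ≤ Fintype.card ↥(nodes 2 (l + 3) J) - 1 := by
        intro b
        have hb := F.wt_le v b
        have hroot : ∀ r : ↥(nodes 2 (l + 3) J), r.1.1 = 1 →
            (F.T r).card + 2 * (l + 2) ≤ Fintype.card ↥(nodes 2 (l + 3) J) - 1 := by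
          intro r hr
          have hr2 := (hmem r).2.1
          rw [hTc, hr]
          rw [hr] at hr2
          have := h.one _ hr2
          omega
        refine le_trans (Nat.add_le_add_right (Nat.mul_le_mul_left _ hb) _) ?_
        rw [hdep]
        obtain ⟨hb1, hb2, -⟩ := hmem b
        rcases Nat.lt_or_ge 2 b.1.1 with h3 | h3
        · obtain ⟨r, hr, -⟩ := F.exists_root b
          rw [hdep] at hr
          have := hroot r hr
          have := (hdeep b r h3 hr).1
          omega
        · rcases h3.eq_or_lt with h4 | h4
          · rw [hTc, h4]
            rw [h4] at hb2
            have := h.two _ hb2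
            omega
          · have h5 : b.1.1 = 1 := by omega
            have := hroot b h5
            rw [h5]
            omega
      have hwx : F.dep x * F.wt v x ≤ 2 * (l + 2) := by
        have h1 := hlow x (by have := F.card_kids_le x; omega)
        have h2 := Nat.mul_le_mul_left (F.dep x) (F.wt_le v x)
        have h3 := F.dep_le x
        refine h2.trans ?_
        rcases h1.2 with h4 | h4
        · have := Nat.mul_le_mul h3 h4
          omega
        · rw [hdep, h4.1]
          have := Nat.mul_le_mul_left (l + 2) h1.1
          omega
      rw [← Finset.add_sum_erase _ _ hxQ]
      have hcQ := Finset.card_erase_of_mem hxQ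
      rcases Nat.eq_zero_or_pos (Q.erase x).card with h0 | h0
      · rw [Finset.card_eq_zero.mp h0, Finset.sum_empty]
        have := hw x
        omega
      · obtain ⟨b, hb⟩ := Finset.card_eq_one.mp (show (Q.erase x).card = 1 by omega)
        rw [hb, Finset.sum_singleton]
        have := hw b
        omega
  · left
    refine F.sum_le_of_le_root hP' hQ fun z hzQ r hz hr hvr => ?_
    have hvr : v ∉ F.T r := hvr.resolve_left (Finset.card_pos.mp hv1).ne_empty
    rw [F.wt_eq_of_notMem hvr (F.kid_ne_root hr)]
    rw [hdep] at hz hr ⊢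
    obtain ⟨hz1, hz2, -⟩ := hmem z
    rcases Nat.lt_or_ge 2 z.1.1 with h3 | h3
    · exact (Nat.mul_le_mul_left _ (F.wt_le v z)).trans (hdeep z r h3 hr).1
    · have h4 : z.1.1 = 2 := by omega
      have hvm := hmem v
      obtain ⟨hTv, h5⟩ := hlow v hv
      have hTv1 : 2 ≤ (F.T v).card := by
        obtain ⟨b, hb⟩ := Finset.card_pos.mp hv1
        have h6 : ({v, b} : Finset _) ⊆ F.T v := by
          intro y hy
          rcases Finset.mem_insert.mp hy with rfl | hy
          · exact F.mem_T_self _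
          · rw [Finset.mem_singleton.mp hy]
            exact (F.mem_T_kid hb).mpr (Or.inr (F.mem_T_self _))
        refine le_trans ?_ (Finset.card_le_card h6)
        rw [Finset.card_pair]
        rintro rfl
        have := F.dep_kid hb
        omega
      obtain ⟨h6, -, h7⟩ := h5.resolve_left (by omega)
      have hr2 := (hmem r).2.1
      rw [hr] at hr2
      have h8 : r.1.2 = 1 - v.1.2 % 2 := by
        have : ¬ (r.1.1 ≤ v.1.1 ∧ v.1.2 % 2 ^ r.1.1 = r.1.2) := fun h => hvr ((hT _ _).mpr h)
        rw [hr, pow_one] at this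
        omega
      have hv2 := hvm.2.1
      rw [h6] at hv2
      rw [h4] at hz2 ⊢
      have hTz := hTc z
      rw [h4] at hTz
      rw [hTc r, hr, h8]
      rcases h.partial_two _ hv2 h7 _ hz2 with h9 | ⟨h9, h10⟩
      · have := F.wt_le v z
        omega
      · have h11 : v ∈ F.T z := (hT _ _).mpr (by rw [h4]; exact ⟨by omega, h9⟩)
        have h12 : F.wt v z + 2 ≤ (F.T z).card := by
          obtain ⟨b, hb⟩ := Finset.card_pos.mp hv1
          have h13 : insert v (F.kids v) ⊆ F.T z := by
            intro y hy
            rcases Finset.mem_insert.mp hy with rfl | hy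
            · exact h11
            · exact (F.mem_T_kid hy).mpr (Or.inr h11)
          have h14 : v ∉ F.kids v := fun h => by
            have := F.dep_kid h
            omega
          have h15 := Finset.card_sdiff_add_card_eq_card h13
          rw [Finset.card_insert_of_notMem h14] at h15
          rw [Forest.wt]
          omega
        omega

end Binary

section Binary

variable {l : ℕ}

theorem balanced_range {m : ℕ} (hm : 1 ≤ m) (hmL : m ≤ 2 ^ (l + 3)) (hl : l = 0 → 4 ≤ m)
    (h4 : m % 4 = 1 → m = 1) : Balanced l (Finset.range m) := by
  have hP : l < 2 ^ l := Nat.lt_two_pow_self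
  have hc := fun d i (hi : i < 2 ^ d) => cnt_range (k := 2) (by omega) m d i hi
  have hc1 : ∀ r < 2, cnt 2 (Finset.range m) 1 r = m / 2 + if r < m % 2 then 1 else 0 := hc 1
  have hc2 : ∀ r < 4, cnt 2 (Finset.range m) 2 r = m / 4 + if r < m % 4 then 1 else 0 := hc 2
  have hc3 : ∀ r < 8, cnt 2 (Finset.range m) 3 r = m / 8 + if r < m % 8 then 1 else 0 := hc 3
  have hcl := hc (l + 2)
  have e2 : 2 ^ (l + 2) = 4 * 2 ^ l := by ring
  have e3 : 2 ^ (l + 3) = 8 * 2 ^ l := by ring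
  rw [e3] at hmL
  have hl0 : l = 0 → 2 ^ l = 1 := by rintro rfl; rfl
  refine ⟨by rw [e3]; exact Finset.range_subset_range.mpr hmL, ?_, ?_, ?_, ?_, ?_⟩
  · intro i hi h1 z hz
    rw [hc2 z hz, hc1 _ (by omega)]
    by_cases hm1 : m = 1
    · subst hm1
      rw [hcl i hi, e2, Nat.div_eq_of_lt (by omega), Nat.mod_eq_of_lt (by omega)] at h1
      have : i = 0 := by
        by_contra h0
        rw [if_neg (by omega)] at h1
        omega
      subst this
      split_ifs <;> omega
    · split_ifs <;> omega
  · intro r hr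
    rw [hc1 r hr, Finset.card_range]
    split_ifs <;> omega
  · intro r hr
    rw [hc2 r hr, Finset.card_range]
    split_ifs <;> omega
  · intro z hz r hr
    rw [hc2 z hz, hc1 r hr]
    split_ifs <;> omega
  · intro z hz r hr
    rw [hc3 z hz, hc1 r hr]
    split_ifs <;> omega

theorem exists_twin_set {a i₀ : ℕ} (ha : a ≤ 2 ^ (l + 2)) (hi₀ : i₀ < a) :
    ∃ J ⊆ Finset.range (2 ^ (l + 3)), ∀ d ≤ l + 2, ∀ i,
      cnt 2 J d i + (if i₀ % 2 ^ d = i then 1 else 0) = 2 * cnt 2 (Finset.range a) d i := by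
  refine ⟨Finset.range a ∪ ((Finset.range a).erase i₀).image (2 ^ (l + 2) + ·), ?_, ?_⟩
  · intro j hj
    rw [pow_succ 2 (l + 2)]
    simp only [Finset.mem_union, Finset.mem_range, Finset.mem_image, Finset.mem_erase] at hj ⊢
    rcases hj with hj | ⟨x, hx, rfl⟩ <;> omega
  · intro d hd i
    have hmod : ∀ x, (2 ^ (l + 2) + x) % 2 ^ d = x % 2 ^ d := by
      intro x
      obtain ⟨q, hq⟩ := Nat.exists_eq_add_of_le hd
      rw [hq, pow_add, Nat.mul_add_mod]
    have h1 : cnt 2 (Finset.range a ∪ ((Finset.range a).erase i₀).image (2 ^ (l + 2) + ·)) d i =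
        cnt 2 (Finset.range a) d i + cnt 2 ((Finset.range a).erase i₀) d i := by
      rw [cnt, Finset.filter_union, Finset.card_union_of_disjoint, Finset.filter_image,
        Finset.card_image_of_injective _ (add_right_injective _)]
      · simp_rw [hmod, cnt]
      · rw [Finset.disjoint_left]
        intro j h1 h2
        simp only [Finset.mem_filter, Finset.mem_range, Finset.mem_image] at h1 h2
        obtain ⟨⟨x, -, hx⟩, -⟩ := h2
        omega
    have h2 : cnt 2 ((Finset.range a).erase i₀) d i + (if i₀ % 2 ^ d = i then 1 else 0) =
        cnt 2 (Finset.range a) d i := by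
      have h3 : cnt 2 (insert i₀ ((Finset.range a).erase i₀)) d i = cnt 2 (Finset.range a) d i := by
        rw [Finset.insert_erase (Finset.mem_range.mpr hi₀)]
      rw [← h3, cnt, cnt, Finset.filter_insert]
      split_ifs with h
      · rw [Finset.card_insert_of_notMem]
        simp
      · rfl
    omega

theorem exists_balanced {t : ℕ} (ht : 1 ≤ t) (hl : 1 ≤ l) (hl1 : l = 1 → 2 ≤ t)
    (htL : 4 * t + 1 ≤ 2 ^ (l + 3)) : ∃ J, J.card = 4 * t + 1 ∧ Balanced l J := by
  have hP : l < 2 ^ l := Nat.lt_two_pow_self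
  have e2 : 2 ^ (l + 2) = 4 * 2 ^ l := by ring
  have e3 : 2 ^ (l + 3) = 8 * 2 ^ l := by ring
  rw [e3] at htL
  have hP4 : l ≠ 1 → 4 ≤ 2 ^ l := fun h => Nat.pow_le_pow_right (n := 2) (by omega) (show 2 ≤ l by omega)
  obtain ⟨i₀, hi₀, hi2⟩ : ∃ i₀, i₀ < 2 * t + 1 ∧
      (t % 2 = 0 ∧ i₀ = 2 * t ∨ t % 2 = 1 ∧ i₀ = 2 * t - 1) := by
    rcases Nat.mod_two_eq_zero_or_one t with h | h
    · exact ⟨2 * t, by omega, Or.inl ⟨h, rfl⟩⟩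
    · exact ⟨2 * t - 1, by omega, Or.inr ⟨h, rfl⟩⟩
  obtain ⟨J, hJ, hcnt⟩ := exists_twin_set (l := l) (a := 2 * t + 1) (by omega) hi₀
  have hc := fun d i (hi : i < 2 ^ d) => cnt_range (k := 2) (by omega) (2 * t + 1) d i hi
  have hc1 : ∀ r < 2, cnt 2 J 1 r + (if i₀ % 2 = r then 1 else 0) =
      2 * ((2 * t + 1) / 2 + if r < (2 * t + 1) % 2 then 1 else 0) := fun r hr => by
    simpa only [hc 1 r hr, pow_one] using hcnt 1 (by omega) r
  have hc2 : ∀ r < 4, cnt 2 J 2 r + (if i₀ % 4 = r then 1 else 0) =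
      2 * ((2 * t + 1) / 4 + if r < (2 * t + 1) % 4 then 1 else 0) := fun r hr => by
    rw [← show 2 ^ 2 = 4 from rfl, hcnt 2 (by omega), hc 2 r hr]
  have hc3 : ∀ r < 8, cnt 2 J 3 r ≤
      2 * ((2 * t + 1) / 8 + if r < (2 * t + 1) % 8 then 1 else 0) := fun r hr => by
    rw [← show 2 ^ 3 = 8 from rfl, ← hc 3 r hr, ← hcnt 3 (by omega)]
    omega
  have hcard : J.card = 4 * t + 1 := by
    have h := hcnt 0 (by omega) 0
    have h1 : ∀ A, cnt 2 A 0 0 = A.card := fun A => by simp [cnt, Nat.mod_one]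
    rw [h1, h1, Finset.card_range, pow_zero, Nat.mod_one, if_pos rfl] at h
    omega
  have ha1 : ∀ r < 2, cnt 2 J 1 r = 2 * t + (if t % 2 = 0 then if r = 0 then 1 else 0
      else if r = 0 then 2 else 0) - (if t % 2 = 1 then r else 0) := by
    intro r hr
    have := hc1 r hr
    split_ifs at this ⊢ <;> omega
  have ha2 : ∀ z < 4, cnt 2 J 2 z ≤ t + 1 := by
    intro z hz
    have := hc2 z hz
    split_ifs at this <;> omega
  refine ⟨J, hcard, hJ, ?_, ?_, ?_, ?_, ?_⟩
  · intro i hi h1 z hz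
    have h2 := hcnt (l + 2) le_rfl i
    rw [h1, Nat.mod_eq_of_lt (by omega)] at h2
    have : i₀ = i := by
      by_contra h0
      rw [if_neg h0] at h2
      omega
    subst this
    rw [ha1 _ (by omega)]
    have := hc2 z hz
    have := ha2 z hz
    split_ifs at * <;> omega
  · intro r hr
    rw [ha1 r hr, hcard]
    split_ifs <;> omega
  · intro z hz
    have := ha2 z hz
    omega
  · intro z hz r hr
    have := ha2 z hz
    rw [ha1 r hr]
    split_ifs <;> omega
  · intro z hz r hr
    have := hc3 z hz
    rw [ha1 r hr]
    split_ifs at * <;> omega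

end Binary

/-! ### Small exceptional sizes: a verified checker for explicit tables

A table lists the out-neighbours of each node. Lower bounds for all deviations of a node `v` come
from the rows of the distance matrix of the table without the links of `v`, increased by one. -/

section Tables

/-- Slotwise minimum, written with recursors so that it evaluates quickly in the kernel. -/
noncomputable def rowMin (x : List ℕ) : List ℕ → List ℕ :=
  List.rec (fun _ => [])
    (fun a _ ih y => List.casesOn y [] (fun b y => (a - (a - b)) :: ih y)) x

/-- The sum of a list, written with a recursor so that it evaluates quickly in the kernel. -/
noncomputable def rowSum (x : List ℕ) : ℕ := List.rec 0 (fun a _ ih => a + ih) x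

/-- Relaxed distances plus one, after `p` rounds. -/
noncomputable def distRows (out : List (List ℕ)) (n : ℕ) : ℕ → List (List ℕ)
  | 0 => (List.range n).map fun z => (List.range n).map fun u => bif u == z then 1 else n
  | i + 1 =>
    let D := distRows out n i
    D.zipWith (fun r o => o.foldl (fun r a => rowMin r ((D.getD a []).map (· + 1))) r) out

/-- Distances from `v` when `v` has no links. -/
def startRow (n v : ℕ) : List ℕ := (List.range n).map fun u => bif u == v then 0 else n

/-- Distances from `v` when `v` links to the nodes of `t`. -/
noncomputable def linkRow (D : List (List ℕ)) (acc : List ℕ) (t : List ℕ) : List ℕ :=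
  t.foldl (fun acc z => rowMin acc (D.getD z [])) acc

/-- No choice of at most `j` further links among a list brings the total below `b`. -/
noncomputable def noBetter (D : List (List ℕ)) (b : ℕ) : List ℕ → ℕ → List ℕ → Bool
  | [], _, acc => Nat.ble b (rowSum acc)
  | _ :: _, 0, acc => Nat.ble b (rowSum acc)
  | z :: zs, j + 1, acc =>
    noBetter D b zs j (rowMin acc (D.getD z [])) && noBetter D b zs (j + 1) acc

/-- Along the links of every node but `v` the row increases by at most one. -/
def lipschitzRow (out : List (List ℕ)) (n v : ℕ) (r : List ℕ) : Bool :=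
  (List.range n).all fun a => (a == v) ||
    (out.getD a []).all fun b => Nat.ble (r.getD b 0) (r.getD a 0 + 1)

/-- Every positive entry is witnessed by a link from a node with a smaller entry. -/
def reachRow (out : List (List ℕ)) (n v : ℕ) (r : List ℕ) : Bool :=
  (List.range n).all fun u => (u == v) ||
    (List.range n).any fun a => (out.getD a []).contains u &&
      Nat.ble (r.getD a 0 + 1) (r.getD u 0)

noncomputable def ownRow (out : List (List ℕ)) (n p v : ℕ) : List ℕ :=
  linkRow (distRows (out.set v []) n p) (startRow n v) (out.getD v [])

noncomputable def checkNode (out : List (List ℕ)) (n k q p v : ℕ) : Bool :=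
  let D := distRows (out.set v []) n p
  let r := ownRow out n p v
  !(out.getD v []).contains v && Nat.ble (out.getD v []).length k &&
  ((out.getD v []).all fun z => Nat.ble (z + 1) n) &&
  ((List.range n).all fun z => Nat.beq (D.getD z []).length n && Nat.ble ((D.getD z []).getD z 0) 1
    && lipschitzRow out n v (D.getD z [])) &&
  reachRow out n v r && (r.all fun d => Nat.ble d q) &&
  noBetter D (rowSum r) (List.range n) k (startRow n v)

variable {out : List (List ℕ)} {n : ℕ}

theorem rowMin_eq_zipWith (x y : List ℕ) :
    rowMin x y = x.zipWith (fun a b => a - (a - b)) y := by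
  induction x generalizing y with
  | nil => rfl
  | cons a x ih =>
    cases y with
    | nil => rfl
    | cons b y => exact congrArg _ (ih y)

theorem rowSum_eq_sum (x : List ℕ) : rowSum x = x.sum := by
  induction x with
  | nil => rfl
  | cons a x ih => rw [List.sum_cons, ← ih]; rfl

theorem length_rowMin {x y : List ℕ} (hx : x.length = n) (hy : y.length = n) :
    (rowMin x y).length = n := by simp [rowMin_eq_zipWith, hx, hy]

theorem getD_rowMin {x y : List ℕ} (hx : x.length = n) (hy : y.length = n) (u : ℕ) :
    (rowMin x y).getD u 0 = min (x.getD u 0) (y.getD u 0) := by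
  by_cases h : u < n
  · have h1 : u < x.length := by omega
    have h2 : u < y.length := by omega
    have h3 : u < (rowMin x y).length := by rw [length_rowMin hx hy]; exact h
    simp only [List.getD_eq_getElem _ _ h1, List.getD_eq_getElem _ _ h2,
      List.getD_eq_getElem _ _ h3]
    simp only [rowMin_eq_zipWith, List.getElem_zipWith]
    omega
  · rw [List.getD_eq_default, List.getD_eq_default, List.getD_eq_default]
    · rfl
    all_goals first | omega | (rw [length_rowMin hx hy]; omega)

theorem getD_startRow {v u : ℕ} (hu : u < n) :
    (startRow n v).getD u 0 = if u = v then 0 else n := by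
  simp [startRow, hu, Bool.cond_eq_ite]

/-- A row of the right length that increases by at most one along the links of nodes other
than `v`. -/
def IsRow (out : List (List ℕ)) (n v : ℕ) (r : List ℕ) : Prop :=
  r.length = n ∧ ∀ a < n, a ≠ v → ∀ b < n, b ∈ out.getD a [] → r.getD b 0 ≤ r.getD a 0 + 1

theorem isRow_startRow (v : ℕ) : IsRow out n v (startRow n v) := by
  refine ⟨by simp [startRow], fun a ha hav b hb _ => ?_⟩
  rw [getD_startRow ha, getD_startRow hb, if_neg hav]
  split_ifs <;> omega

theorem IsRow.rowMin {v : ℕ} {x y : List ℕ} (hx : IsRow out n v x) (hy : IsRow out n v y) :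
    IsRow out n v (rowMin x y) := by
  refine ⟨length_rowMin hx.1 hy.1, fun a ha hav b hb hab => ?_⟩
  rw [getD_rowMin hx.1 hy.1, getD_rowMin hx.1 hy.1]
  have h1 := hx.2 a ha hav b hb hab
  have h2 := hy.2 a ha hav b hb hab
  omega

theorem isRow_linkRow {D : List (List ℕ)} {v : ℕ} (hD : ∀ z < n, IsRow out n v (D.getD z []))
    (t : List ℕ) (ht : ∀ z ∈ t, z < n) (acc : List ℕ) (hacc : IsRow out n v acc) :
    IsRow out n v (linkRow D acc t) ∧
      (∀ u, (linkRow D acc t).getD u 0 ≤ acc.getD u 0) ∧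
      ∀ z ∈ t, ∀ u, (linkRow D acc t).getD u 0 ≤ (D.getD z []).getD u 0 := by
  induction t generalizing acc with
  | nil => exact ⟨hacc, fun _ => le_rfl, by simp⟩
  | cons z t ih =>
    have hz := hD z (ht z (by simp))
    obtain ⟨h1, h2, h3⟩ := ih (fun y hy => ht y (by simp [hy])) _ (hacc.rowMin hz)
    have h4 : linkRow D acc (z :: t) = linkRow D (rowMin acc (D.getD z [])) t := rfl
    rw [h4]
    refine ⟨h1, fun u => (h2 u).trans ?_, fun y hy u => ?_⟩
    · rw [getD_rowMin hacc.1 hz.1]; exact min_le_left _ _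
    · rcases List.mem_cons.mp hy with rfl | hy
      · refine (h2 u).trans ?_
        rw [getD_rowMin hacc.1 hz.1]; exact min_le_right _ _
      · exact h3 y hy u

theorem le_sum_linkRow_of_noBetter {D : List (List ℕ)} {b : ℕ} (zs : List ℕ) (j : ℕ)
    (acc : List ℕ) (h : noBetter D b zs j acc = true) (t : List ℕ) (ht : t.Sublist zs)
    (hj : t.length ≤ j) : b ≤ (linkRow D acc t).sum := by
  induction zs generalizing j acc t with
  | nil =>
    obtain rfl := List.sublist_nil.mp ht
    simpa [noBetter, linkRow, rowSum_eq_sum] using h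
  | cons z zs ih =>
    cases j with
    | zero =>
      obtain rfl := List.length_eq_zero_iff.mp (Nat.le_zero.mp hj)
      simpa [noBetter, linkRow, rowSum_eq_sum] using h
    | succ j =>
      simp only [noBetter, Bool.and_eq_true] at h
      cases ht with
      | cons _ ht => exact ih _ _ h.2 _ ht hj
      | cons_cons _ ht => exact ih _ _ h.1 _ ht (by simpa using hj)

/-- The wiring described by a table. -/
def tableWiring (out : List (List ℕ)) (n : ℕ) (v : Fin n) : Finset (Fin n) :=
  Finset.univ.filter fun u => u.1 ∈ out.getD v.1 []

theorem sum_filter_getD {r : List ℕ} (hr : r.length = n) (v : Fin n) (hv : r.getD v.1 0 = 0) :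
    ∑ u ∈ Finset.univ.filter (fun u => u ≠ v), r.getD u.1 0 = r.sum := by
  have h1 : ∑ u : Fin n, r.getD u.1 0 = r.sum := by
    subst hr
    rw [← Fin.sum_univ_getElem r]
    exact Finset.sum_congr rfl fun u _ => by simp
  rw [← h1, Finset.sum_filter]
  refine Finset.sum_congr rfl fun u _ => ?_
  split_ifs with h
  · rfl
  · rw [not_not.mp h, hv]

theorem connIn_of_reachRow {r : List ℕ} {v : Fin n} (h : reachRow out n v r = true)
    (d : ℕ) (u : Fin n) (hd : r.getD u.1 0 ≤ d) : connIn (tableWiring out n) d v u := by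
  induction d generalizing u with
  | zero =>
    by_cases huv : u = v
    · subst huv; rfl
    · simp only [reachRow, List.all_eq_true, List.mem_range, Bool.or_eq_true, beq_iff_eq,
        List.any_eq_true, Bool.and_eq_true, Nat.ble_eq] at h
      rcases h u u.2 with h | ⟨a, -, -, h⟩
      · exact absurd (Fin.ext h) huv
      · omega
  | succ d ih =>
    by_cases huv : u = v
    · subst huv; exact connIn_refl _ _ _
    · have h' := h
      simp only [reachRow, List.all_eq_true, List.mem_range, Bool.or_eq_true, beq_iff_eq,
        List.any_eq_true, Bool.and_eq_true, Nat.ble_eq] at h'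
      rcases h' u u.2 with h' | ⟨a, ha, hau, h'⟩
      · exact absurd (Fin.ext h') huv
      · have h1 := ih ⟨a, ha⟩ (by simp only; omega)
        exact connIn_trans h1 (connIn_one (by simpa [tableWiring] using hau))

theorem checkNode_sound {k q p M : ℕ} (hM : n ≤ M) (v : Fin n)
    (h : checkNode out n k q p v = true) :
    (v ∉ tableWiring out n v ∧ (tableWiring out n v).card ≤ k) ∧
    (∀ t : Finset (Fin n), t.card ≤ k →
      cost (tableWiring out n) M v ≤ cost (Function.update (tableWiring out n) v t) M v) ∧
    (∀ u, distW (tableWiring out n) M v u ≤ q) ∧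
    cost (tableWiring out n) M v ≤ (ownRow out n p v).sum := by
  simp only [checkNode, rowSum_eq_sum, Bool.and_eq_true, Bool.not_eq_true', Nat.ble_eq] at h
  obtain ⟨⟨⟨⟨⟨⟨hself, hcard⟩, hout⟩, hrows⟩, hreach⟩, hq⟩, hno⟩ := h
  set D := distRows (out.set v []) n p with hDdef
  simp only [List.all_eq_true, List.mem_range, Bool.and_eq_true, Nat.beq_eq, Nat.ble_eq,
    lipschitzRow, Bool.or_eq_true, beq_iff_eq] at hrows
  have hD : ∀ z < n, IsRow out n v (D.getD z []) := fun z hz =>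
    ⟨(hrows z hz).1.1, fun a ha hav b _ hab => ((hrows z hz).2 a ha).resolve_left hav b hab⟩
  have hstart : (startRow n v).getD v.1 0 = 0 := by rw [getD_startRow v.2, if_pos rfl]
  have hown0 : (ownRow out n p v).getD v.1 0 = 0 ∧ (ownRow out n p v).length = n := by
    obtain ⟨h1, h2, -⟩ := isRow_linkRow hD (out.getD v []) (fun z hz => by
      simp only [List.all_eq_true, Nat.ble_eq] at hout
      exact hout z hz) _ (isRow_startRow v)
    exact ⟨Nat.le_zero.mp ((h2 v).trans hstart.le), h1.1⟩
  have hle : cost (tableWiring out n) M v ≤ (ownRow out n p v).sum := by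
    rw [← sum_filter_getD hown0.2 v hown0.1]
    exact cost_le fun u _ => connIn_of_reachRow hreach _ u le_rfl
  refine ⟨⟨?_, ?_⟩, fun t ht => hle.trans ?_, fun u => ?_, hle⟩
  · simpa [tableWiring] using hself
  · refine le_trans ?_ hcard
    rw [← Finset.card_map Fin.valEmbedding]
    refine le_trans (Finset.card_le_card fun x hx => ?_) (List.toFinset_card_le _)
    simp only [tableWiring, Finset.mem_map, Finset.mem_filter, Finset.mem_univ, true_and,
      Fin.valEmbedding_apply] at hx
    obtain ⟨u, hu, rfl⟩ := hx
    exact List.mem_toFinset.mpr hu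
  · set l := ((List.finRange n).filter (· ∈ t)).map Fin.val with hl
    have hmem : ∀ z, z ∈ l ↔ ∃ u ∈ t, u.1 = z := by
      intro z; simp [hl]
    have hlt : ∀ z ∈ l, z < n := by
      intro z hz; obtain ⟨u, -, rfl⟩ := (hmem z).mp hz; exact u.2
    have hsub : l.Sublist (List.range n) := by
      rw [← List.map_coe_finRange_eq_range]
      exact List.filter_sublist.map _
    have hlen : l.length ≤ k := by
      refine le_trans (le_of_eq ?_) ht
      have hnd : l.Nodup := List.nodup_range.sublist hsub
      rw [← List.toFinset_card_of_nodup hnd, ← Finset.card_map Fin.valEmbedding]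
      congr 1; ext z; simp [hmem]
    refine (le_sum_linkRow_of_noBetter _ _ _ hno l hsub hlen).trans ?_
    obtain ⟨h1, h2, h3⟩ := isRow_linkRow hD l hlt _ (isRow_startRow v)
    have h0 : (linkRow D (startRow n v) l).getD v.1 0 = 0 := by
      have := h2 v; omega
    rw [← sum_filter_getD h1.1 v h0]
    refine le_cost_of_potential h0 (fun u => ?_) fun a b hab => ?_
    · refine (h2 u).trans ?_
      rw [getD_startRow u.2]; split_ifs <;> omega
    · by_cases hav : a = v
      · subst hav
        rw [Function.update_self] at hab
        have := h3 b ((hmem b).mpr ⟨b, hab, rfl⟩) b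
        have := (hrows b b.2).1.2
        omega
      · rw [Function.update_of_ne hav] at hab
        exact h1.2 a a.2 (fun h => hav (Fin.ext h)) b b.2 (by simpa [tableWiring] using hab)
  · have hu : (ownRow out n p v).getD u.1 0 ≤ q := by
      have h1 : u.1 < (ownRow out n p v).length := by rw [hown0.2]; exact u.2
      rw [List.getD_eq_getElem _ _ h1]
      simp only [List.all_eq_true, Nat.ble_eq] at hq
      exact hq _ (List.getElem_mem _)
    exact (distW_le (connIn_of_reachRow hreach _ u le_rfl)).trans hu

noncomputable def checkTable (out : List (List ℕ)) (n k q p T : ℕ) : Bool :=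
  ((List.range n).all fun v => checkNode out n k q p v) &&
    Nat.ble (rowSum ((List.range n).map fun v => rowSum (ownRow out n p v))) T

theorem good_of_checkTable {k e p T M : ℕ} (hk : 2 ≤ k) (he : k ^ e < n) (hM : n ^ 2 < M)
    (hT : T ≤ 2 * (n * costBound k n (e + 1)))
    (h : checkTable out n k (2 * (e + 1)) p T = true) : Good (Fin n) k M := by
  simp only [checkTable, rowSum_eq_sum, Bool.and_eq_true, List.all_eq_true, List.mem_range, Nat.ble_eq] at h
  have hnM : n ≤ M := by nlinarith
  have hs := fun v : Fin n => checkNode_sound hnM v (h.1 v v.2)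
  have hlog : e + 1 ≤ Nat.clog k n := (Nat.lt_clog_iff_pow_lt (by omega)).mpr he
  have hen : e < n := (Nat.lt_pow_self (by omega)).trans he
  refine ⟨tableWiring out n, fun v => (hs v).1, fun v t _ ht => (hs v).2.1 t ht, fun v u => ?_,
    e + 1, by omega, ?_⟩
  · rw [Fintype.card_fin]
    exact ((hs v).2.2.1 u).trans (by omega)
  · rw [Fintype.card_fin]
    refine le_trans (Finset.sum_le_sum fun v _ => (hs v).2.2.2) (le_trans ?_ (h.2.trans hT))
    rw [← List.map_coe_finRange_eq_range, List.map_map, ← List.ofFn_eq_map, List.sum_ofFn]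
    rfl

set_option maxRecDepth 100000

theorem good_two_seven {M : ℕ} (hM : 7 ^ 2 < M) : Good (Fin 7) 2 M :=
  good_of_checkTable (e := 2) (p := 4) (T := 80)
    (out := [[2, 4], [3, 5], [1, 6], [0, 1], [0, 1], [0, 1], [0, 1]])
    le_rfl (by norm_num) hM (by simp [costBound, geom, Finset.sum_range_succ]) (by decide +kernel)

theorem good_two_eight {M : ℕ} (hM : 8 ^ 2 < M) : Good (Fin 8) 2 M :=
  good_of_checkTable (e := 2) (p := 5) (T := 108)
    (out := [[1, 4], [5, 7], [3, 5], [0, 1], [2, 3], [4, 6], [1, 4], [3, 5]])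
    le_rfl (by norm_num) hM (by simp [costBound, geom, Finset.sum_range_succ]) (by decide +kernel)

theorem good_two_nine {M : ℕ} (hM : 9 ^ 2 < M) : Good (Fin 9) 2 M :=
  good_of_checkTable (e := 3) (p := 5) (T := 156)
    (out := [[2, 4], [3, 5], [1, 6], [0, 7], [1, 8], [0, 1], [0, 1], [0, 1], [0, 1]])
    le_rfl (by norm_num) hM (by simp [costBound, geom, Finset.sum_range_succ]) (by decide +kernel)

theorem good_two_eleven {M : ℕ} (hM : 11 ^ 2 < M) : Good (Fin 11) 2 M :=
  good_of_checkTable (e := 3) (p := 5) (T := 264)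
    (out := [[2, 4], [3, 5], [6, 9], [0, 7], [8, 10], [0, 1], [0, 1], [0, 1], [0, 1], [0, 1],
      [0, 1]])
    le_rfl (by norm_num) hM (by simp [costBound, geom, Finset.sum_range_succ]) (by decide +kernel)

theorem good_two_nineteen {M : ℕ} (hM : 19 ^ 2 < M) : Good (Fin 19) 2 M :=
  good_of_checkTable (e := 4) (p := 6) (T := 1049)
    (out := [[2, 4], [3, 5], [6, 10], [7, 11], [8, 12], [9, 13], [14, 17], [0, 15], [16, 18],
      [0, 1], [0, 1], [0, 1], [0, 1], [0, 1], [0, 1], [0, 1], [0, 1], [0, 1], [0, 1]])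
    le_rfl (by norm_num) hM (by simp [costBound, geom, Finset.sum_range_succ]) (by decide +kernel)

theorem good_three_thirteen {M : ℕ} (hM : 13 ^ 2 < M) : Good (Fin 13) 3 M :=
  good_of_checkTable (e := 2) (p := 4) (T := 305)
    (out := [[3, 6, 9], [4, 7, 10], [5, 8, 11], [1, 2, 12], [0, 1, 2], [0, 1, 2], [0, 1, 2],
      [0, 1, 2], [0, 1, 2], [0, 1, 2], [0, 1, 2], [0, 1, 2], [0, 1, 2]])
    (by norm_num) (by norm_num) hM (by simp [costBound, geom, Finset.sum_range_succ])
    (by decide +kernel)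

theorem good_three_fourteen {M : ℕ} (hM : 14 ^ 2 < M) : Good (Fin 14) 3 M :=
  good_of_checkTable (e := 2) (p := 4) (T := 370)
    (out := [[3, 6, 9], [4, 7, 10], [5, 8, 11], [1, 2, 12], [0, 2, 13], [0, 1, 2], [0, 1, 2],
      [0, 1, 2], [0, 1, 2], [0, 1, 2], [0, 1, 2], [0, 1, 2], [0, 1, 2], [0, 1, 2]])
    (by norm_num) (by norm_num) hM (by simp [costBound, geom, Finset.sum_range_succ])
    (by decide +kernel)

end Tables

/-! ### The main theorem -/

theorem exists_levels {k n : ℕ} (hk : 1 ≤ k) (hn : k + k ^ 2 < n) :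
    ∃ L m, 3 ≤ L ∧ 1 ≤ m ∧ m ≤ k ^ L ∧ n = ∑ e ∈ Finset.Ico 1 L, k ^ e + m := by
  have key : ∀ d, n ≤ ∑ e ∈ Finset.Ico 1 (d + 3), k ^ e →
      ∃ L m, 3 ≤ L ∧ 1 ≤ m ∧ m ≤ k ^ L ∧ n = ∑ e ∈ Finset.Ico 1 L, k ^ e + m := by
    intro d
    induction d with
    | zero =>
      intro h
      rw [zero_add, Finset.sum_Ico_eq_sum_range] at h
      simp [Finset.sum_range_succ] at h
      omega
    | succ d ih =>
      intro h
      by_cases h' : n ≤ ∑ e ∈ Finset.Ico 1 (d + 3), k ^ e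
      · exact ih h'
      · have h2 : d + 1 + 3 = d + 3 + 1 := by omega
        rw [h2, Finset.sum_Ico_succ_top (by omega)] at h
        exact ⟨d + 3, n - ∑ e ∈ Finset.Ico 1 (d + 3), k ^ e, by omega, by omega, by omega,
          by omega⟩
  refine key n ?_
  calc n ≤ (Finset.Ico 1 (n + 3)).card • 1 := by simp
    _ ≤ _ := Finset.card_nsmul_le_sum _ _ _ fun e _ => Nat.one_le_pow _ _ hk

theorem good_of_good_nodes {k L n M : ℕ} {J : Finset ℕ} (hk : 1 ≤ k) (hL : 1 ≤ L)
    (hJ : J ⊆ Finset.range (k ^ L)) (hn : n = ∑ e ∈ Finset.Ico 1 L, k ^ e + J.card)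
    (hM : n ^ 2 < M)
    (h : Fintype.card ↥(nodes k L J) ^ 2 < M → Good ↥(nodes k L J) k M) : Good (Fin n) k M := by
  have hcard : Fintype.card ↥(nodes k L J) = n := by rw [card_nodes hk hL hJ, hn]
  exact Good.of_equiv (Fintype.equivFinOfCardEq hcard) (h (by rwa [hcard]))

theorem good_fin_of_three_le {k n M : ℕ} (hk : 3 ≤ k) (hn : k + k ^ 2 < n) (hM : n ^ 2 < M) :
    Good (Fin n) k M := by
  obtain ⟨L, m, hL, hm, hmL, hnm⟩ := exists_levels (by omega) hn
  by_cases hex : 4 ≤ k ∨ 4 ≤ L ∨ 3 ≤ m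
  · exact good_of_good_nodes (J := Finset.range m) (by omega) (by omega)
      (Finset.range_subset_range.mpr hmL) (by simpa using hnm) hM
      (good_nodes_of_three_le hk hL hm hmL hex)
  · obtain rfl : k = 3 := by omega
    obtain rfl : L = 3 := by omega
    have h12 : ∑ e ∈ Finset.Ico 1 3, 3 ^ e = 12 := by decide
    rw [h12] at hnm
    obtain rfl | rfl : n = 13 ∨ n = 14 := by omega
    · exact good_three_thirteen hM
    · exact good_three_fourteen hM

theorem good_fin_two {n M : ℕ} (hn : 2 + 2 ^ 2 < n) (hM : n ^ 2 < M) : Good (Fin n) 2 M := by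
  obtain ⟨L, m, hL, hm, hmL, hnm⟩ := exists_levels (by omega) hn
  obtain ⟨l, rfl⟩ := Nat.exists_eq_add_of_le' hL
  have of_balanced : ∀ J : Finset ℕ, J.card = m → Balanced l J → Good (Fin n) 2 M := by
    intro J hJ hb
    exact good_of_good_nodes (L := l + 3) (by omega) (by omega) hb.sub (by rw [hJ]; exact hnm) hM
      (good_nodes_of_balanced hb (by omega))
  have h6 : ∑ e ∈ Finset.Ico 1 3, 2 ^ e = 6 := by decide
  have h14 : ∑ e ∈ Finset.Ico 1 4, 2 ^ e = 14 := by decide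
  by_cases h4 : m % 4 = 1 → m = 1
  · by_cases hl : l = 0 → 4 ≤ m
    · exact of_balanced _ (Finset.card_range m) (balanced_range hm hmL hl h4)
    · obtain ⟨rfl, hm4⟩ := Classical.not_imp.mp hl
      rw [zero_add, h6] at hnm
      obtain rfl | rfl | rfl : n = 7 ∨ n = 8 ∨ n = 9 := by omega
      · exact good_two_seven hM
      · exact good_two_eight hM
      · exact good_two_nine hM
  · obtain ⟨h4, hm1⟩ := Classical.not_imp.mp h4
    by_cases hl : 1 ≤ l ∧ (l = 1 → 2 ≤ m / 4)
    · obtain ⟨J, hJ, hb⟩ := exists_balanced (t := m / 4) (l := l) (by omega) hl.1 hl.2 (by omega)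
      exact of_balanced J (by omega) hb
    · obtain rfl | rfl : l = 0 ∨ l = 1 := by omega
      · obtain rfl : m = 5 := by omega
        rw [zero_add, h6] at hnm
        subst hnm
        exact good_two_eleven hM
      · obtain rfl : m = 5 := by omega
        rw [show 1 + 3 = 4 from rfl, h14] at hnm
        subst hnm
        exact good_two_nineteen hM

theorem good_fin {n k M : ℕ} (hk : 2 ≤ k) (hkn : k < n) (hM : n ^ 2 < M) : Good (Fin n) k M := by
  by_cases hn : n ≤ k ^ 2 + k
  · exact good_of_le_kautz hk hkn hn hM
  · obtain rfl | hk := hk.eq_or_lt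
    · exact good_fin_two (by omega) hM
    · exact good_fin_of_three_le hk (by omega) hM

/-- For every `n ≥ 2` and `2 ≤ k < n` there is a stable wiring in which all
distances are at most `2⌈log_k n⌉` and whose total social cost is at most
twice the optimal social cost over all wirings with out-degree bound `k`. -/
theorem stmt_1 :
    ∀ n : ℕ, 2 ≤ n → ∀ k : ℕ, 2 ≤ k → k < n → ∀ M : ℕ, n ^ 2 < M →
      ∃ s : Fin n → Finset (Fin n), IsWiring k s ∧ Stable k M s ∧
        (∀ v u : Fin n, distW s M v u ≤ 2 * Nat.clog k n) ∧
        (∀ s' : Fin n → Finset (Fin n), IsWiring k s' →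
          ∑ v : Fin n, cost s M v ≤ 2 * ∑ v : Fin n, cost s' M v) := by
  intro n _ k hk hkn M hM
  exact exists_of_good (good_fin hk hkn hM)

end BDNF
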